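/- arXiv:1812.01869 — 2 statements merged into one kernel-verified Lean document; each statement's English description precedes it below -/
import Mathlib

section
/- Let γ₀ and γ be continuous, convex, complete star-shaped curves in (ℝ_{>0})². Then A_{γ₀}(γ)/√(A(γ)) ≥ A_{γ₀}(γ₀)/√(A(γ₀)), with equality if and only if γ = c·γ₀ for some c ∈ ℝ_{>0}. -/
open Real

/-- The `x`-coordinate of the star-shaped curve `θ ↦ (ρ(θ)cos θ, ρ(θ)sin θ)`. -/
noncomputable def Xc (ρ : ℝ → ℝ) : ℝ → ℝ := fun θ => ρ θ * Real.cos θ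

/-- The `y`-coordinate of the star-shaped curve. -/
noncomputable def Yc (ρ : ℝ → ℝ) : ℝ → ℝ := fun θ => ρ θ * Real.sin θ

/-- A continuous complete star-shaped curve in `(ℝ_{>0})²`: `ρ` is continuous and
positive on `[0, π/2]`. -/
def IsStarCurve (ρ : ℝ → ℝ) : Prop :=
  ContinuousOn ρ (Set.Icc 0 (π / 2)) ∧ ∀ θ ∈ Set.Icc (0:ℝ) (π / 2), 0 < ρ θ

/-- Convexity of the curve: `det(γ(θ') − γ(θ), γ(θ'') − γ(θ')) ≥ 0` for `θ < θ' < θ''`. -/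
def IsConvexCurve (ρ : ℝ → ℝ) : Prop :=
  ∀ θ ∈ Set.Icc (0:ℝ) (π / 2), ∀ θ' ∈ Set.Icc (0:ℝ) (π / 2), ∀ θ'' ∈ Set.Icc (0:ℝ) (π / 2),
    θ < θ' → θ' < θ'' →
      0 ≤ (Xc ρ θ' - Xc ρ θ) * (Yc ρ θ'' - Yc ρ θ') -
          (Yc ρ θ' - Yc ρ θ) * (Xc ρ θ'' - Xc ρ θ')

/-- `A(γ)`: the area of the region `{(r cos θ, r sin θ) : 0 ≤ θ ≤ π/2, 0 ≤ r ≤ ρ(θ)}`. -/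
noncomputable def area (ρ : ℝ → ℝ) : ℝ := ∫ θ in (0:ℝ)..(π / 2), ρ θ ^ 2 / 2

/-- `A_{γ₀}(γ) = ∫_γ (max_{q ∈ γ₀} q·ν(p)) dμ_γ(p)` with `dμ_γ = |∂_θ γ| dθ`:
since `ν(θ)·|∂_θ γ(θ)| = (y'(θ), −x'(θ))` (outward unit normal times speed), this is
`∫_0^{π/2} sup_{φ ∈ [0,π/2]} (x₀(φ) y'(θ) − y₀(φ) x'(θ)) dθ` (derivatives exist a.e.). -/
noncomputable def AwSup (ρ₀ ρ : ℝ → ℝ) : ℝ :=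
  ∫ θ in (0:ℝ)..(π / 2),
    ⨆ φ : Set.Icc (0:ℝ) (π / 2),
      (Xc ρ₀ ↑φ * deriv (Yc ρ) θ - Yc ρ₀ ↑φ * deriv (Xc ρ) θ)

open Set Filter Topology MeasureTheory

section Curve

variable {ρ ρ₁ ρ₂ : ℝ → ℝ}

theorem Xc_mul_Yc_sub (ρ₁ ρ₂ : ℝ → ℝ) (φ θ : ℝ) :
    Xc ρ₁ φ * Yc ρ₂ θ - Yc ρ₁ φ * Xc ρ₂ θ = ρ₁ φ * ρ₂ θ * Real.sin (θ - φ) := by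
  simp only [Xc, Yc, Real.sin_sub]; ring

theorem Xc_sq_add_Yc_sq (ρ : ℝ → ℝ) (θ : ℝ) : Xc ρ θ ^ 2 + Yc ρ θ ^ 2 = ρ θ ^ 2 := by
  simp only [Xc, Yc]; linear_combination ρ θ ^ 2 * Real.sin_sq_add_cos_sq θ

theorem wedge_pos (h₁ : IsStarCurve ρ₁) (h₂ : IsStarCurve ρ₂) {φ θ : ℝ}
    (hφ : φ ∈ Icc (0 : ℝ) (π / 2)) (hθ : θ ∈ Icc (0 : ℝ) (π / 2)) (hlt : φ < θ) :
    0 < Xc ρ₁ φ * Yc ρ₂ θ - Yc ρ₁ φ * Xc ρ₂ θ := by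
  rw [Xc_mul_Yc_sub]
  have := Real.sin_pos_of_pos_of_lt_pi (sub_pos.2 hlt) (by linarith [hφ.1, hθ.2, Real.pi_pos])
  have := h₁.2 φ hφ
  have := h₂.2 θ hθ
  positivity

theorem polar_injective (h₁ : IsStarCurve ρ₁) (h₂ : IsStarCurve ρ₂) {φ θ : ℝ}
    (hφ : φ ∈ Icc (0 : ℝ) (π / 2)) (hθ : θ ∈ Icc (0 : ℝ) (π / 2))
    (hX : Xc ρ₁ φ = Xc ρ₂ θ) (hY : Yc ρ₁ φ = Yc ρ₂ θ) : φ = θ := by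
  rcases lt_trichotomy φ θ with hlt | heq | hlt
  · have := wedge_pos h₁ h₂ hφ hθ hlt
    rw [hX, hY] at this; nlinarith
  · exact heq
  · have := wedge_pos h₂ h₁ hθ hφ hlt
    rw [hX, hY] at this; nlinarith

theorem eq_of_Xc_eq {θ : ℝ}
    (hθ : θ ∈ Ico (0 : ℝ) (π / 2)) (hX : Xc ρ₁ θ = Xc ρ₂ θ) : ρ₁ θ = ρ₂ θ := by
  have := Real.cos_pos_of_mem_Ioo ⟨by linarith [hθ.1, Real.pi_pos], hθ.2⟩
  exact mul_right_cancel₀ this.ne' hX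

namespace IsStarCurve

theorem continuousOn_Xc (h : IsStarCurve ρ) : ContinuousOn (Xc ρ) (Icc 0 (π / 2)) :=
  h.1.mul Real.continuous_cos.continuousOn

theorem continuousOn_Yc (h : IsStarCurve ρ) : ContinuousOn (Yc ρ) (Icc 0 (π / 2)) :=
  h.1.mul Real.continuous_sin.continuousOn

theorem Xc_nonneg (h : IsStarCurve ρ) {θ : ℝ} (hθ : θ ∈ Icc (0 : ℝ) (π / 2)) : 0 ≤ Xc ρ θ :=
  mul_nonneg (h.2 θ hθ).le (Real.cos_nonneg_of_mem_Icc ⟨by linarith [hθ.1, Real.pi_pos], hθ.2⟩)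

theorem Xc_pos (h : IsStarCurve ρ) {θ : ℝ} (hθ : θ ∈ Ico (0 : ℝ) (π / 2)) : 0 < Xc ρ θ :=
  mul_pos (h.2 θ ⟨hθ.1, hθ.2.le⟩)
    (Real.cos_pos_of_mem_Ioo ⟨by linarith [hθ.1, Real.pi_pos], hθ.2⟩)

theorem Yc_nonneg (h : IsStarCurve ρ) {θ : ℝ} (hθ : θ ∈ Icc (0 : ℝ) (π / 2)) : 0 ≤ Yc ρ θ :=
  mul_nonneg (h.2 θ hθ).le
    (Real.sin_nonneg_of_nonneg_of_le_pi hθ.1 (by linarith [hθ.2, Real.pi_pos]))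

theorem Yc_pos (h : IsStarCurve ρ) {θ : ℝ} (hθ : θ ∈ Ioc (0 : ℝ) (π / 2)) : 0 < Yc ρ θ :=
  mul_pos (h.2 θ ⟨hθ.1.le, hθ.2⟩)
    (Real.sin_pos_of_pos_of_lt_pi hθ.1 (by linarith [hθ.2, Real.pi_pos]))

theorem area_pos (h : IsStarCurve ρ) : 0 < area ρ := by
  have hpi : (0 : ℝ) < π / 2 := by positivity
  refine intervalIntegral.intervalIntegral_pos_of_pos_on ?_ (fun θ hθ => ?_) hpi
  · apply ContinuousOn.intervalIntegrable
    rw [uIcc_of_le hpi.le]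
    exact (h.1.pow 2).div_const 2
  · have := h.2 θ ⟨hθ.1.le, hθ.2.le⟩
    positivity

end IsStarCurve

@[simp] theorem Yc_zero (ρ : ℝ → ℝ) : Yc ρ 0 = 0 := by simp [Yc]

@[simp] theorem Xc_pi_div_two (ρ : ℝ → ℝ) : Xc ρ (π / 2) = 0 := by simp [Xc]

/-- Each point of the curve lies beyond the chord between two others. -/
theorem IsConvexCurve.exists_chord (hc : IsConvexCurve ρ) (h : IsStarCurve ρ) {r s t : ℝ}
    (hr : r ∈ Icc (0 : ℝ) (π / 2)) (hs : s ∈ Icc (0 : ℝ) (π / 2)) (ht : t ∈ Icc (0 : ℝ) (π / 2))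
    (hrs : r < s) (hst : s < t) :
    ∃ p q : ℝ, 0 < p ∧ 0 < q ∧ 1 ≤ p + q ∧
      Xc ρ s = p * Xc ρ r + q * Xc ρ t ∧ Yc ρ s = p * Yc ρ r + q * Yc ρ t := by
  have h₁₂ := wedge_pos h h hr hs hrs
  have h₂₃ := wedge_pos h h hs ht hst
  have h₁₃ := wedge_pos h h hr ht (hrs.trans hst)
  have hdet := hc r hr s hs t ht hrs hst
  refine ⟨_, _, div_pos h₂₃ h₁₃, div_pos h₁₂ h₁₃, ?_, ?_, ?_⟩
  · rw [← add_div, le_div_iff₀ h₁₃]; linarith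
  · rw [div_mul_eq_mul_div, div_mul_eq_mul_div, ← add_div, eq_div_iff h₁₃.ne']; ring
  · rw [div_mul_eq_mul_div, div_mul_eq_mul_div, ← add_div, eq_div_iff h₁₃.ne']; ring

end Curve

/-- A nonnegative function whose value at each point is at least a combination, of total weight at
least one, of the values on either side. -/
def IsUnimodal (f : ℝ → ℝ) (a b : ℝ) : Prop :=
  (∀ t ∈ Icc a b, 0 ≤ f t) ∧ ∀ r ∈ Icc a b, ∀ s ∈ Icc a b, ∀ t ∈ Icc a b, r < s → s < t →
    ∃ p q : ℝ, 0 < p ∧ 0 < q ∧ 1 ≤ p + q ∧ f s = p * f r + q * f t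

namespace IsUnimodal

variable {f : ℝ → ℝ} {a b c : ℝ}

theorem le_of_le (hf : IsUnimodal f a b) {r s t : ℝ} (hr : r ∈ Icc a b) (ht : t ∈ Icc a b)
    (hrs : r ≤ s) (hst : s ≤ t) {m : ℝ} (hmr : m ≤ f r) (hmt : m ≤ f t) : m ≤ f s := by
  rcases hrs.eq_or_lt with rfl | hrs
  · exact hmr
  rcases hst.eq_or_lt with rfl | hst
  · exact hmt
  have hs : s ∈ Icc a b := ⟨hr.1.trans hrs.le, hst.le.trans ht.2⟩
  obtain ⟨p, q, hp, hq, hpq, he⟩ := hf.2 r hr s hs t ht hrs hst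
  have := hf.1 s hs
  rcases le_total 0 m with hm | hm
  · nlinarith
  · linarith

theorem lt_of_lt_left (hf : IsUnimodal f a b) {r s t : ℝ} (hr : r ∈ Icc a b) (ht : t ∈ Icc a b)
    (hrs : r < s) (hst : s ≤ t) (hlt : f r < f t) : f r < f s := by
  rcases hst.eq_or_lt with rfl | hst
  · exact hlt
  obtain ⟨p, q, hp, hq, hpq, he⟩ :=
    hf.2 r hr s ⟨hr.1.trans hrs.le, hst.le.trans ht.2⟩ t ht hrs hst
  have := hf.1 r hr
  nlinarith

theorem lt_of_lt_right (hf : IsUnimodal f a b) {r s t : ℝ} (hr : r ∈ Icc a b) (ht : t ∈ Icc a b)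
    (hrs : r ≤ s) (hst : s < t) (hlt : f t < f r) : f t < f s := by
  rcases hrs.eq_or_lt with rfl | hrs
  · exact hlt
  obtain ⟨p, q, hp, hq, hpq, he⟩ :=
    hf.2 r hr s ⟨hr.1.trans hrs.le, hst.le.trans ht.2⟩ t ht hrs hst
  have := hf.1 t ht
  nlinarith

theorem monotoneOn (hf : IsUnimodal f a b) (hc : c ∈ Icc a b) (hmax : ∀ t ∈ Icc a b, f t ≤ f c) :
    MonotoneOn f (Icc a c) := fun r hr _ hs hrs =>
  hf.le_of_le ⟨hr.1, hr.2.trans hc.2⟩ hc hrs hs.2 le_rfl (hmax r ⟨hr.1, hr.2.trans hc.2⟩)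

theorem antitoneOn (hf : IsUnimodal f a b) (hc : c ∈ Icc a b) (hmax : ∀ t ∈ Icc a b, f t ≤ f c) :
    AntitoneOn f (Icc c b) := fun _ hs t ht hst =>
  hf.le_of_le hc ⟨hc.1.trans ht.1, ht.2⟩ hs.1 hst (hmax t ⟨hc.1.trans ht.1, ht.2⟩) le_rfl

theorem strictMonoOn (hf : IsUnimodal f a b) (hc : c ∈ Icc a b)
    (hmax : ∀ t ∈ Icc a b, t < c → f t < f c) : StrictMonoOn f (Icc a c) := fun r hr _ hs hrs =>
  hf.lt_of_lt_left ⟨hr.1, hr.2.trans hc.2⟩ hc hrs hs.2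
    (hmax r ⟨hr.1, hr.2.trans hc.2⟩ (hrs.trans_le hs.2))

theorem strictAntiOn (hf : IsUnimodal f a b) (hc : c ∈ Icc a b)
    (hmax : ∀ t ∈ Icc a b, c < t → f t < f c) : StrictAntiOn f (Icc c b) := fun _ hs t ht hst =>
  hf.lt_of_lt_right hc ⟨hc.1.trans ht.1, ht.2⟩ hs.1 hst
    (hmax t ⟨hc.1.trans ht.1, ht.2⟩ (hs.1.trans_lt hst))

theorem exists_max (hfc : ContinuousOn f (Icc a b)) (hab : a ≤ b) :
    ∃ c ∈ Icc a b, ∃ d ∈ Icc a b, c ≤ d ∧ f c = f d ∧ (∀ t ∈ Icc a b, f t ≤ f c) ∧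
      (∀ t ∈ Icc a b, t < c → f t < f c) ∧ (∀ t ∈ Icc a b, d < t → f t < f d) := by
  obtain ⟨m, hm, hmax⟩ := isCompact_Icc.exists_isMaxOn (nonempty_Icc.2 hab) hfc
  have hmax' : ∀ t ∈ Icc a b, f t ≤ f m := fun t ht => hmax ht
  have hK : IsCompact (Icc a b ∩ f ⁻¹' {f m}) :=
    isCompact_Icc.of_isClosed_subset (hfc.preimage_isClosed_of_isClosed isClosed_Icc
      isClosed_singleton) inter_subset_left
  have hne : (Icc a b ∩ f ⁻¹' {f m}).Nonempty := ⟨m, hm, rfl⟩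
  obtain ⟨c, ⟨hc, hcm⟩, hcl⟩ := hK.exists_isLeast hne
  obtain ⟨d, ⟨hd, hdm⟩, hdl⟩ := hK.exists_isGreatest hne
  have hcm : f c = f m := hcm
  have hdm : f d = f m := hdm
  refine ⟨c, hc, d, hd, hcl ⟨hd, hdm⟩, hcm.trans hdm.symm, fun t ht => hcm ▸ hmax' t ht, ?_, ?_⟩
  · intro t ht htc
    refine lt_of_le_of_ne (hcm ▸ hmax' t ht) fun he => ?_
    exact absurd (hcl ⟨ht, he.trans hcm⟩) (not_le.2 htc)
  · intro t ht htc
    refine lt_of_le_of_ne (hdm ▸ hmax' t ht) fun he => ?_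
    exact absurd (hdl ⟨ht, he.trans hdm⟩) (not_le.2 htc)

theorem intervalIntegrable_deriv (hf : IsUnimodal f a b) (hfc : ContinuousOn f (Icc a b))
    (hab : a ≤ b) : IntervalIntegrable (deriv f) volume a b := by
  obtain ⟨c, hc, -, -, -, -, hmax, -⟩ := exists_max hfc hab
  refine IntervalIntegrable.trans (b := c) ?_ ?_
  · apply MonotoneOn.intervalIntegrable_deriv
    rw [uIcc_of_le hc.1]
    exact hf.monotoneOn hc hmax
  · have : IntervalIntegrable (deriv (-f)) volume c b := by
      apply MonotoneOn.intervalIntegrable_deriv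
      rw [uIcc_of_le hc.2]
      exact (hf.antitoneOn hc hmax).neg
    have h2 := this.neg
    rw [deriv.neg'] at h2
    exact h2.congr (fun t _ => neg_neg _)

theorem ae_differentiableAt (hf : IsUnimodal f a b) (hfc : ContinuousOn f (Icc a b))
    (hab : a ≤ b) : ∀ᵐ t, t ∈ Ioo a b → DifferentiableAt ℝ f t := by
  obtain ⟨c, hc, -, -, -, -, hmax, -⟩ := exists_max hfc hab
  have hne : ∀ᵐ t : ℝ, t ≠ c := by
    simp [ae_iff, measure_singleton]
  filter_upwards [(hf.monotoneOn hc hmax).ae_differentiableWithinAt_of_mem,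
    (hf.antitoneOn hc hmax).neg.ae_differentiableWithinAt_of_mem, hne] with t h1 h2 h3 ht
  rcases lt_or_gt_of_ne h3 with hlt | hlt
  · exact (h1 ⟨ht.1.le, hlt.le⟩).differentiableAt (Icc_mem_nhds ht.1 hlt)
  · have := ((h2 ⟨hlt.le, ht.2.le⟩).differentiableAt (Icc_mem_nhds hlt ht.2)).neg
    simpa using this

end IsUnimodal

theorem IsConvexCurve.isUnimodal_Xc {ρ : ℝ → ℝ} (hc : IsConvexCurve ρ) (h : IsStarCurve ρ) :
    IsUnimodal (Xc ρ) 0 (π / 2) := by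
  refine ⟨fun t ht => h.Xc_nonneg ht, fun r hr s hs t ht hrs hst => ?_⟩
  obtain ⟨p, q, hp, hq, hpq, hX, -⟩ := hc.exists_chord h hr hs ht hrs hst
  exact ⟨p, q, hp, hq, hpq, hX⟩

theorem IsConvexCurve.isUnimodal_Yc {ρ : ℝ → ℝ} (hc : IsConvexCurve ρ) (h : IsStarCurve ρ) :
    IsUnimodal (Yc ρ) 0 (π / 2) := by
  refine ⟨fun t ht => h.Yc_nonneg ht, fun r hr s hs t ht hrs hst => ?_⟩
  obtain ⟨p, q, hp, hq, hpq, -, hY⟩ := hc.exists_chord h hr hs ht hrs hst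
  exact ⟨p, q, hp, hq, hpq, hY⟩

section Regularity

variable {ρ : ℝ → ℝ}

theorem Yc_arctan (ρ : ℝ → ℝ) (u : ℝ) : Yc ρ (Real.arctan u) = u * Xc ρ (Real.arctan u) := by
  have hcos := Real.cos_arctan_pos u
  have : Real.sin (Real.arctan u) = u * Real.cos (Real.arctan u) := by
    conv_rhs => rw [← Real.tan_arctan u]
    rw [Real.arctan_tan (Real.neg_pi_div_two_lt_arctan u) (Real.arctan_lt_pi_div_two u),
      Real.tan_mul_cos hcos.ne']
  simp only [Xc, Yc, this]; ring

theorem arctan_mem_Ioo {u : ℝ} (hu : 0 < u) : Real.arctan u ∈ Ioo 0 (π / 2) :=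
  ⟨Real.arctan_pos.2 hu, Real.arctan_lt_pi_div_two u⟩

theorem IsConvexCurve.convexOn_inv_Xc_arctan (hc : IsConvexCurve ρ) (h : IsStarCurve ρ) :
    ConvexOn ℝ (Ioi 0) fun u => (Xc ρ (Real.arctan u))⁻¹ := by
  refine convexOn_of_slope_mono_adjacent (convex_Ioi 0) fun {u v w} hu hw huv hvw => ?_
  have hv : 0 < v := lt_trans hu huv
  have mu := arctan_mem_Ioo hu
  have mv := arctan_mem_Ioo hv
  have mw := arctan_mem_Ioo hw
  have hdet := hc _ (Ioo_subset_Icc_self mu) _ (Ioo_subset_Icc_self mv) _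
    (Ioo_subset_Icc_self mw) (Real.arctan_strictMono huv) (Real.arctan_strictMono hvw)
  have pu := h.Xc_pos (Ioo_subset_Ico_self mu)
  have pv := h.Xc_pos (Ioo_subset_Ico_self mv)
  have pw := h.Xc_pos (Ioo_subset_Ico_self mw)
  simp only [Yc_arctan] at hdet
  generalize Xc ρ (Real.arctan u) = a at *
  generalize Xc ρ (Real.arctan v) = b at *
  generalize Xc ρ (Real.arctan w) = c at *
  rw [div_le_div_iff₀ (sub_pos.2 huv) (sub_pos.2 hvw), inv_sub_inv pv.ne' pu.ne',
    inv_sub_inv pw.ne' pv.ne', div_mul_eq_mul_div, div_mul_eq_mul_div,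
    div_le_div_iff₀ (by positivity) (by positivity)]
  have key : (a - b) * (w - v) * c ≤ (b - c) * (v - u) * a := by nlinarith
  nlinarith [mul_le_mul_of_nonneg_left key pv.le]

theorem IsConvexCurve.differentiableWithinAt_Xc (hc : IsConvexCurve ρ) (h : IsStarCurve ρ) {θ : ℝ}
    (hθ : θ ∈ Ioo 0 (π / 2)) : DifferentiableWithinAt ℝ (Xc ρ) (Ioi θ) θ := by
  have hmem : ∀ t ∈ Ico θ (π / 2), t ∈ Ioo (-(π / 2)) (π / 2) := fun t ht =>
    ⟨by linarith [ht.1, hθ.1, Real.pi_pos], ht.2⟩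
  have htan : 0 < Real.tan θ := Real.tan_pos_of_pos_of_lt_pi_div_two hθ.1 hθ.2
  have hW : DifferentiableWithinAt ℝ (fun u => (Xc ρ (Real.arctan u))⁻¹)
      (Ioi (Real.tan θ)) (Real.tan θ) :=
    (hc.convexOn_inv_Xc_arctan h).differentiableWithinAt_Ioi_of_mem_interior
      (by rw [interior_Ioi]; exact htan)
  have hcos : Real.cos θ ≠ 0 :=
    (Real.cos_pos_of_mem_Ioo (hmem θ ⟨le_rfl, hθ.2⟩)).ne'
  have hcomp := hW.comp θ (t := Ioi (Real.tan θ)) (s := Ioo θ (π / 2))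
    (Real.differentiableAt_tan.2 hcos).differentiableWithinAt
    (fun t ht => Real.strictMonoOn_tan (hmem θ ⟨le_rfl, hθ.2⟩) (hmem t ⟨ht.1.le, ht.2⟩) ht.1)
  have hat : ∀ t ∈ Ico θ (π / 2), Real.arctan (Real.tan t) = t := fun t ht =>
    Real.arctan_tan (hmem t ht).1 (hmem t ht).2
  have hinv := hcomp.inv (by
    simp only [Function.comp, hat θ ⟨le_rfl, hθ.2⟩]
    exact (inv_pos.2 (h.Xc_pos ⟨hθ.1.le, hθ.2⟩)).ne')
  refine (hinv.congr (f₁ := Xc ρ) (fun t ht => ?_) ?_).mono_of_mem_nhdsWithin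
    (Ioo_mem_nhdsGT hθ.2)
  · simp [hat t ⟨ht.1.le, ht.2⟩]
  · simp [hat θ ⟨le_rfl, hθ.2⟩]

theorem Yc_eq_tan_mul_Xc (ρ : ℝ → ℝ) {θ : ℝ} (hθ : θ ∈ Ioo (-(π / 2)) (π / 2)) :
    Yc ρ θ = Real.tan θ * Xc ρ θ := by
  have := Real.tan_mul_cos (Real.cos_pos_of_mem_Ioo hθ).ne'
  simp only [Xc, Yc]; linear_combination -ρ θ * this

theorem IsConvexCurve.differentiableWithinAt_Yc (hc : IsConvexCurve ρ) (h : IsStarCurve ρ) {θ : ℝ}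
    (hθ : θ ∈ Ioo 0 (π / 2)) : DifferentiableWithinAt ℝ (Yc ρ) (Ioi θ) θ := by
  have hmem : ∀ t ∈ Ico θ (π / 2), t ∈ Ioo (-(π / 2)) (π / 2) := fun t ht =>
    ⟨by linarith [ht.1, hθ.1, Real.pi_pos], ht.2⟩
  have hcos : Real.cos θ ≠ 0 :=
    (Real.cos_pos_of_mem_Ioo (hmem θ ⟨le_rfl, hθ.2⟩)).ne'
  have hprod := ((Real.differentiableAt_tan.2 hcos).differentiableWithinAt (s := Ioi θ)).mul
    (hc.differentiableWithinAt_Xc h hθ)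
  refine ((hprod.mono Ioo_subset_Ioi_self).congr (f₁ := Yc ρ) (s := Ioo θ (π / 2))
    (fun t ht => ?_) ?_).mono_of_mem_nhdsWithin (Ioo_mem_nhdsGT hθ.2)
  · exact Yc_eq_tan_mul_Xc ρ (hmem t ⟨ht.1.le, ht.2⟩)
  · exact Yc_eq_tan_mul_Xc ρ (hmem θ ⟨le_rfl, hθ.2⟩)

theorem IsConvexCurve.ae_differentiableAt (hc : IsConvexCurve ρ) (h : IsStarCurve ρ) :
    ∀ᵐ θ, θ ∈ Ioo 0 (π / 2) → DifferentiableAt ℝ (Xc ρ) θ ∧ DifferentiableAt ℝ (Yc ρ) θ := by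
  have hpi : (0 : ℝ) ≤ π / 2 := by positivity
  filter_upwards [(hc.isUnimodal_Xc h).ae_differentiableAt h.continuousOn_Xc hpi,
    (hc.isUnimodal_Yc h).ae_differentiableAt h.continuousOn_Yc hpi] with θ hX hY hθ
  exact ⟨hX hθ, hY hθ⟩

theorem IsConvexCurve.intervalIntegrable_deriv_Xc (hc : IsConvexCurve ρ) (h : IsStarCurve ρ) :
    IntervalIntegrable (deriv (Xc ρ)) volume 0 (π / 2) :=
  (hc.isUnimodal_Xc h).intervalIntegrable_deriv h.continuousOn_Xc (by positivity)

theorem IsConvexCurve.intervalIntegrable_deriv_Yc (hc : IsConvexCurve ρ) (h : IsStarCurve ρ) :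
    IntervalIntegrable (deriv (Yc ρ)) volume 0 (π / 2) :=
  (hc.isUnimodal_Yc h).intervalIntegrable_deriv h.continuousOn_Yc (by positivity)

/-- The fundamental theorem of calculus for a function with right derivatives everywhere, the
derivative being known almost everywhere. -/
theorem integral_eq_sub_of_differentiableWithinAt_Ioi {f g : ℝ → ℝ} {a b : ℝ} (hab : a ≤ b)
    (hf : ContinuousOn f (Icc a b)) (hd : ∀ t ∈ Ioo a b, DifferentiableWithinAt ℝ f (Ioi t) t)
    (hg : ∀ᵐ t, t ∈ Ioo a b → HasDerivAt f (g t) t) (hintegrable : IntervalIntegrable g volume a b) :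
    ∫ t in a..b, g t = f b - f a := by
  have hne : ∀ᵐ t : ℝ, t ≠ b := by simp [ae_iff, measure_singleton]
  have hae : ∀ᵐ t, t ∈ uIoc a b → g t = derivWithin f (Ioi t) t := by
    filter_upwards [hg, hne] with t h1 h2 h3
    rw [uIoc_of_le hab] at h3
    have := h1 ⟨h3.1, lt_of_le_of_ne h3.2 h2⟩
    exact (this.hasDerivWithinAt.derivWithin (uniqueDiffWithinAt_Ioi t)).symm
  rw [intervalIntegral.integral_congr_ae hae]
  refine intervalIntegral.integral_eq_sub_of_hasDeriv_right_of_le hab hf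
    (fun t ht => (hd t ht).hasDerivWithinAt) (hintegrable.congr_ae ?_)
  rwa [EventuallyEq, ae_restrict_iff' measurableSet_uIoc]

theorem IsConvexCurve.integral_comp_Xc_mul_deriv (hc : IsConvexCurve ρ) (h : IsStarCurve ρ)
    {g : ℝ → ℝ} (hg : Continuous g) {a b : ℝ} (ha : 0 ≤ a) (hab : a ≤ b) (hb : b ≤ π / 2) :
    IntervalIntegrable (fun θ => g (Xc ρ θ) * deriv (Xc ρ) θ) volume a b ∧
      ∫ θ in a..b, g (Xc ρ θ) * deriv (Xc ρ) θ = ∫ x in Xc ρ a..Xc ρ b, g x := by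
  have hsub : Icc a b ⊆ Icc 0 (π / 2) := Icc_subset_Icc ha hb
  have hsub' : Ioo a b ⊆ Ioo 0 (π / 2) := Ioo_subset_Ioo ha hb
  have hX : ContinuousOn (Xc ρ) (Icc a b) := h.continuousOn_Xc.mono hsub
  have hintegrable : IntervalIntegrable (fun θ => g (Xc ρ θ) * deriv (Xc ρ) θ) volume a b := by
    refine IntervalIntegrable.continuousOn_mul ((hc.intervalIntegrable_deriv_Xc h).mono_set ?_) ?_
    · rwa [uIcc_of_le hab, uIcc_of_le (by positivity)]
    · rw [uIcc_of_le hab]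
      exact hg.comp_continuousOn hX
  have hN : ∀ x, HasDerivAt (fun x => ∫ t in (0 : ℝ)..x, g t) (g x) x := fun x =>
    hg.integral_hasStrictDerivAt 0 x |>.hasDerivAt
  refine ⟨hintegrable, ?_⟩
  rw [integral_eq_sub_of_differentiableWithinAt_Ioi
    (f := (fun x => ∫ t in (0 : ℝ)..x, g t) ∘ Xc ρ) hab ?_ ?_ ?_ hintegrable]
  · exact intervalIntegral.integral_interval_sub_left (hg.intervalIntegrable _ _)
      (hg.intervalIntegrable _ _)
  · exact (continuous_iff_continuousAt.2 fun x => (hN x).continuousAt).comp_continuousOn hX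
  · exact fun t ht => (hN (Xc ρ t)).differentiableAt.comp_differentiableWithinAt t
      (hc.differentiableWithinAt_Xc h (hsub' ht))
  · filter_upwards [hc.ae_differentiableAt h] with t ht hmem
    exact (hN (Xc ρ t)).comp t (ht (hsub' hmem)).1.hasDerivAt

/-- The cross product of position and velocity. -/
theorem wedge_deriv {θ : ℝ} (hθ : θ ∈ Ioo 0 (π / 2))
    (hX : DifferentiableAt ℝ (Xc ρ) θ) (hY : DifferentiableAt ℝ (Yc ρ) θ) :
    Xc ρ θ * deriv (Yc ρ) θ - Yc ρ θ * deriv (Xc ρ) θ = ρ θ ^ 2 := by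
  have hcos : 0 < Real.cos θ := Real.cos_pos_of_mem_Ioo
    ⟨by linarith [hθ.1, Real.pi_pos], hθ.2⟩
  have h1 : HasDerivAt (fun t => Yc ρ t * Real.cos t - Xc ρ t * Real.sin t)
      (deriv (Yc ρ) θ * Real.cos θ + Yc ρ θ * -Real.sin θ -
        (deriv (Xc ρ) θ * Real.sin θ + Xc ρ θ * Real.cos θ)) θ :=
    (hY.hasDerivAt.mul (Real.hasDerivAt_cos θ)).sub (hX.hasDerivAt.mul (Real.hasDerivAt_sin θ))
  have h2 : (fun t => Yc ρ t * Real.cos t - Xc ρ t * Real.sin t) = fun _ => 0 := by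
    funext t; simp only [Xc, Yc]; ring
  rw [h2] at h1
  have h3 := h1.unique (hasDerivAt_const θ 0)
  have h4 := Xc_sq_add_Yc_sq ρ θ
  simp only [Xc, Yc] at *
  have h5 := Real.sin_sq_add_cos_sq θ
  linear_combination ρ θ * h3 + ρ θ ^ 2 * h5

theorem IsConvexCurve.integral_Xc_mul_deriv_Yc (hc : IsConvexCurve ρ) (h : IsStarCurve ρ) :
    IntervalIntegrable (fun θ => Xc ρ θ * deriv (Yc ρ) θ) volume 0 (π / 2) ∧
      ∫ θ in (0 : ℝ)..(π / 2), Xc ρ θ * deriv (Yc ρ) θ = area ρ ∧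
      ∫ θ in (0 : ℝ)..(π / 2), Yc ρ θ * deriv (Xc ρ) θ = -area ρ := by
  have hpi : (0 : ℝ) ≤ π / 2 := by positivity
  have hu : uIcc 0 (π / 2) = Icc 0 (π / 2) := uIcc_of_le hpi
  have i1 : IntervalIntegrable (fun θ => Xc ρ θ * deriv (Yc ρ) θ) volume 0 (π / 2) :=
    (hc.intervalIntegrable_deriv_Yc h).continuousOn_mul (hu ▸ h.continuousOn_Xc)
  have i2 : IntervalIntegrable (fun θ => deriv (Xc ρ) θ * Yc ρ θ) volume 0 (π / 2) :=
    (hc.intervalIntegrable_deriv_Xc h).mul_continuousOn (hu ▸ h.continuousOn_Yc)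
  have e1 : ∫ θ in (0 : ℝ)..(π / 2), (deriv (Xc ρ) θ * Yc ρ θ + Xc ρ θ * deriv (Yc ρ) θ) = 0 := by
    rw [integral_eq_sub_of_differentiableWithinAt_Ioi (f := Xc ρ * Yc ρ) hpi
      (h.continuousOn_Xc.mul h.continuousOn_Yc)
      (fun t ht => (hc.differentiableWithinAt_Xc h ht).mul (hc.differentiableWithinAt_Yc h ht))
      ?_ (i2.add i1)]
    · simp
    · filter_upwards [hc.ae_differentiableAt h] with t ht hmem
      exact (ht hmem).1.hasDerivAt.mul (ht hmem).2.hasDerivAt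
  have e2 : ∫ θ in (0 : ℝ)..(π / 2), (Xc ρ θ * deriv (Yc ρ) θ - deriv (Xc ρ) θ * Yc ρ θ) =
      2 * area ρ := by
    rw [area, ← intervalIntegral.integral_const_mul]
    refine intervalIntegral.integral_congr_ae ?_
    have hne : ∀ᵐ t : ℝ, t ≠ π / 2 := by simp [ae_iff, measure_singleton]
    filter_upwards [hc.ae_differentiableAt h, hne] with t ht hne hmem
    rw [uIoc_of_le hpi] at hmem
    have hm : t ∈ Ioo 0 (π / 2) := ⟨hmem.1, lt_of_le_of_ne hmem.2 hne⟩
    rw [mul_comm (deriv (Xc ρ) t), wedge_deriv hm (ht hm).1 (ht hm).2]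
    ring
  rw [intervalIntegral.integral_add i2 i1] at e1
  rw [intervalIntegral.integral_sub i1 i2] at e2
  refine ⟨i1, by linarith, ?_⟩
  simp only [mul_comm (Yc ρ _)]
  linarith

end Regularity

section Support

variable {ρ₀ ρ : ℝ → ℝ}

/-- The support function of the curve `ρ₀` in the direction obtained by turning `(u, v)` clockwise
by a right angle. -/
noncomputable def suppFun (ρ₀ : ℝ → ℝ) (u v : ℝ) : ℝ :=
  ⨆ φ : Icc (0 : ℝ) (π / 2), (Xc ρ₀ ↑φ * v - Yc ρ₀ ↑φ * u)

theorem AwSup_eq (ρ₀ ρ : ℝ → ℝ) :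
    AwSup ρ₀ ρ = ∫ θ in (0 : ℝ)..(π / 2), suppFun ρ₀ (deriv (Xc ρ) θ) (deriv (Yc ρ) θ) := rfl

instance : Nonempty (Icc (0 : ℝ) (π / 2)) := ⟨⟨0, le_rfl, by positivity⟩⟩

theorem IsStarCurve.exists_bound (h : IsStarCurve ρ₀) :
    ∃ M, 0 ≤ M ∧ ∀ u v, ∀ φ : Icc (0 : ℝ) (π / 2),
      |Xc ρ₀ ↑φ * v - Yc ρ₀ ↑φ * u| ≤ M * (|u| + |v|) := by
  obtain ⟨A, hA⟩ := isCompact_Icc.exists_bound_of_continuousOn h.continuousOn_Xc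
  obtain ⟨B, hB⟩ := isCompact_Icc.exists_bound_of_continuousOn h.continuousOn_Yc
  have hA0 : 0 ≤ A := (norm_nonneg _).trans (hA 0 ⟨le_rfl, by positivity⟩)
  have hB0 : 0 ≤ B := (norm_nonneg _).trans (hB 0 ⟨le_rfl, by positivity⟩)
  refine ⟨A + B, by positivity, fun u v φ => ?_⟩
  have h1 := hA φ φ.2
  have h2 := hB φ φ.2
  rw [Real.norm_eq_abs] at h1 h2
  calc |Xc ρ₀ ↑φ * v - Yc ρ₀ ↑φ * u| ≤ |Xc ρ₀ ↑φ * v| + |Yc ρ₀ ↑φ * u| := abs_sub _ _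
    _ = |Xc ρ₀ ↑φ| * |v| + |Yc ρ₀ ↑φ| * |u| := by rw [abs_mul, abs_mul]
    _ ≤ A * |v| + B * |u| := by gcongr
    _ ≤ (A + B) * (|u| + |v|) := by nlinarith [abs_nonneg u, abs_nonneg v]

theorem IsStarCurve.le_suppFun (h : IsStarCurve ρ₀) (u v : ℝ) {φ : ℝ}
    (hφ : φ ∈ Icc (0 : ℝ) (π / 2)) : Xc ρ₀ φ * v - Yc ρ₀ φ * u ≤ suppFun ρ₀ u v := by
  obtain ⟨M, -, hM⟩ := h.exists_bound
  refine le_ciSup (f := fun φ : Icc (0 : ℝ) (π / 2) => Xc ρ₀ ↑φ * v - Yc ρ₀ ↑φ * u)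
    ⟨M * (|u| + |v|), ?_⟩ ⟨φ, hφ⟩
  rintro _ ⟨ψ, rfl⟩
  exact (abs_le.1 (hM u v ψ)).2

theorem IsStarCurve.continuous_suppFun (h : IsStarCurve ρ₀) :
    Continuous fun p : ℝ × ℝ => suppFun ρ₀ p.1 p.2 := by
  have hX : Continuous fun φ : Icc (0 : ℝ) (π / 2) => Xc ρ₀ ↑φ :=
    continuousOn_iff_continuous_domRestrict.1 h.continuousOn_Xc
  have hY : Continuous fun φ : Icc (0 : ℝ) (π / 2) => Yc ρ₀ ↑φ :=
    continuousOn_iff_continuous_domRestrict.1 h.continuousOn_Yc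
  have := (isCompact_univ (X := Icc (0 : ℝ) (π / 2))).continuous_sSup
    (f := fun (p : ℝ × ℝ) (φ : Icc (0 : ℝ) (π / 2)) => Xc ρ₀ ↑φ * p.2 - Yc ρ₀ ↑φ * p.1)
    (((hX.comp continuous_snd).mul (continuous_snd.comp continuous_fst)).sub
      ((hY.comp continuous_snd).mul (continuous_fst.comp continuous_fst)))
  simpa only [suppFun, image_univ, sSup_range] using this

theorem intervalIntegrable_suppFun (h₀ : IsStarCurve ρ₀) (h : IsStarCurve ρ)
    (hc : IsConvexCurve ρ) :
    IntervalIntegrable (fun θ => suppFun ρ₀ (deriv (Xc ρ) θ) (deriv (Yc ρ) θ)) volume 0 (π / 2) := by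
  obtain ⟨M, hM0, hM⟩ := h₀.exists_bound
  refine (((hc.intervalIntegrable_deriv_Xc h).abs.add
    (hc.intervalIntegrable_deriv_Yc h).abs).const_mul M).mono_fun ?_ ?_
  · exact (h₀.continuous_suppFun.measurable.comp
      ((measurable_deriv (Xc ρ)).prodMk (measurable_deriv (Yc ρ)))).aestronglyMeasurable
  · refine Eventually.of_forall fun θ => ?_
    have hb := hM (deriv (Xc ρ) θ) (deriv (Yc ρ) θ)
    simp only [Real.norm_eq_abs]
    refine le_trans ?_ (le_abs_self _)
    refine abs_le.2 ⟨?_, ciSup_le fun φ => (abs_le.1 (hb φ)).2⟩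
    have h0 : (0 : ℝ) ∈ Icc 0 (π / 2) := ⟨le_rfl, by positivity⟩
    exact (abs_le.1 (hb ⟨0, h0⟩)).1.trans (h₀.le_suppFun _ _ h0)

/-- The tangent line supports a convex curve. -/
theorem IsConvexCurve.wedge_deriv_le (hc : IsConvexCurve ρ) {θ φ : ℝ}
    (hθ : θ ∈ Ioo 0 (π / 2)) (hφ : φ ∈ Icc (0 : ℝ) (π / 2))
    (hX : DifferentiableAt ℝ (Xc ρ) θ) (hY : DifferentiableAt ℝ (Yc ρ) θ) :
    Xc ρ φ * deriv (Yc ρ) θ - Yc ρ φ * deriv (Xc ρ) θ ≤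
      Xc ρ θ * deriv (Yc ρ) θ - Yc ρ θ * deriv (Xc ρ) θ := by
  have hw : HasDerivAt
      (fun t => (Xc ρ θ - Xc ρ φ) * (Yc ρ t - Yc ρ θ) - (Yc ρ θ - Yc ρ φ) * (Xc ρ t - Xc ρ θ))
      ((Xc ρ θ - Xc ρ φ) * deriv (Yc ρ) θ - (Yc ρ θ - Yc ρ φ) * deriv (Xc ρ) θ) θ :=
    ((hY.hasDerivAt.sub_const _).const_mul _).sub ((hX.hasDerivAt.sub_const _).const_mul _)
  have hθI := Ioo_subset_Icc_self hθ
  rcases lt_trichotomy φ θ with hlt | rfl | hlt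
  · have h1 : Tendsto (slope _ θ) (𝓝[>] θ) _ :=
      (hasDerivAt_iff_tendsto_slope.1 hw).mono_left (nhdsWithin_mono _ fun t ht => ht.ne')
    have := ge_of_tendsto h1 (b := 0) (by
      filter_upwards [Ioo_mem_nhdsGT hθ.2] with t ht
      have := hc φ hφ θ hθI t ⟨hθ.1.le.trans ht.1.le, ht.2.le⟩ hlt ht.1
      rw [slope_def_field]
      exact div_nonneg (by simpa using this) (sub_nonneg.2 ht.1.le))
    linarith
  · exact le_rfl
  · have h1 : Tendsto (slope _ θ) (𝓝[<] θ) _ :=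
      (hasDerivAt_iff_tendsto_slope.1 hw).mono_left (nhdsWithin_mono _ fun t ht => ht.ne)
    have := ge_of_tendsto h1 (b := 0) (by
      filter_upwards [Ioo_mem_nhdsLT hθ.1] with t ht
      have := hc t ⟨ht.1.le, ht.2.le.trans hθI.2⟩ θ hθI φ hφ ht.2 hlt
      rw [slope_def_field]
      refine div_nonneg_of_nonpos ?_ (sub_nonpos.2 ht.2.le)
      simp only [sub_self, mul_zero, sub_zero]
      linarith)
    linarith

theorem IsConvexCurve.suppFun_deriv (hc : IsConvexCurve ρ) (h : IsStarCurve ρ) {θ : ℝ}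
    (hθ : θ ∈ Ioo 0 (π / 2))
    (hX : DifferentiableAt ℝ (Xc ρ) θ) (hY : DifferentiableAt ℝ (Yc ρ) θ) :
    suppFun ρ (deriv (Xc ρ) θ) (deriv (Yc ρ) θ) = ρ θ ^ 2 := by
  rw [← wedge_deriv hθ hX hY]
  exact le_antisymm (ciSup_le fun φ => hc.wedge_deriv_le hθ φ.2 hX hY)
    (h.le_suppFun _ _ (Ioo_subset_Icc_self hθ))

theorem IsConvexCurve.AwSup_self (hc : IsConvexCurve ρ) (h : IsStarCurve ρ) :
    AwSup ρ ρ = 2 * area ρ := by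
  have hpi : (0 : ℝ) ≤ π / 2 := by positivity
  rw [AwSup_eq, area, ← intervalIntegral.integral_const_mul]
  refine intervalIntegral.integral_congr_ae ?_
  have hne : ∀ᵐ t : ℝ, t ≠ π / 2 := by simp [ae_iff, measure_singleton]
  filter_upwards [hc.ae_differentiableAt h, hne] with t ht hne hmem
  rw [uIoc_of_le hpi] at hmem
  have hm : t ∈ Ioo 0 (π / 2) := ⟨hmem.1, lt_of_le_of_ne hmem.2 hne⟩
  rw [hc.suppFun_deriv h hm (ht hm).1 (ht hm).2]
  ring

end Support

section Graph

/-- A continuous injective coordinate on an interval lets another one be written as a continuous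
function of it. -/
theorem exists_continuous_graph {f g : ℝ → ℝ} {c d p q : ℝ} (hpq : p ≤ q)
    (hf : ContinuousOn f (Icc c d)) (hg : ContinuousOn g (Icc c d)) (hinj : InjOn f (Icc c d))
    (himg : f '' Icc c d = Icc p q) :
    ∃ k : ℝ → ℝ, Continuous k ∧ (∀ t ∈ Icc c d, k (f t) = g t) ∧
      ∀ x, ∃ t ∈ Icc c d, f t = max p (min q x) ∧ k x = g t := by
  have hmaps : MapsTo f (Icc c d) (Icc p q) := himg ▸ mapsTo_image f _
  have hbij : Function.Bijective (hmaps.restrict f (Icc c d) (Icc p q)) := by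
    constructor
    · exact (hmaps.restrict_inj).2 hinj
    · rintro ⟨y, hy⟩
      obtain ⟨t, ht, rfl⟩ := himg.symm ▸ hy
      exact ⟨⟨t, ht⟩, rfl⟩
  have hcont : Continuous (Equiv.ofBijective _ hbij) := hf.mapsToRestrict hmaps
  let e := hcont.homeoOfEquivCompactToT2
  have he : ∀ t : Icc c d, (e t : ℝ) = f t := fun t => rfl
  refine ⟨fun x => g (e.symm (projIcc p q hpq x)), ?_, fun t ht => ?_, fun x => ?_⟩
  · exact (continuousOn_iff_continuous_domRestrict.1 hg).comp
      (e.symm.continuous.comp continuous_projIcc)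
  · have : projIcc p q hpq (f t) = e ⟨t, ht⟩ := by
      rw [projIcc_of_mem hpq (hmaps ht)]; rfl
    simp only [this, Homeomorph.symm_apply_apply]
  · refine ⟨_, (e.symm (projIcc p q hpq x)).2, ?_, rfl⟩
    rw [← he, Homeomorph.apply_symm_apply]; rfl

/-- The region under the curve `ρ` is described by the graphs of `k₁` (below) and `k₂` (above) over
`[0, a]`, where `a` is the greatest abscissa, first reached at `c` and last reached at `d`. -/
structure IsGraphPair (ρ : ℝ → ℝ) (c d a : ℝ) (k₁ k₂ : ℝ → ℝ) : Prop where
  nonneg : 0 ≤ c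
  le : c ≤ d
  lt : d < π / 2
  Xc_eq : ∀ t ∈ Icc c d, Xc ρ t = a
  Xc_le : ∀ t ∈ Icc 0 (π / 2), Xc ρ t ≤ a
  monotoneOn : MonotoneOn (Xc ρ) (Icc 0 d)
  strictMonoOn : StrictMonoOn (Xc ρ) (Icc 0 c)
  strictAntiOn : StrictAntiOn (Xc ρ) (Icc d (π / 2))
  continuous_lower : Continuous k₁
  continuous_upper : Continuous k₂
  lower_Xc : ∀ t ∈ Icc 0 c, k₁ (Xc ρ t) = Yc ρ t
  upper_Xc : ∀ t ∈ Icc d (π / 2), k₂ (Xc ρ t) = Yc ρ t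
  exists_lower : ∀ x, ∃ t ∈ Icc 0 c, Xc ρ t = max (Xc ρ 0) (min a x) ∧ k₁ x = Yc ρ t
  exists_upper : ∀ x, ∃ t ∈ Icc d (π / 2), Xc ρ t = max 0 (min a x) ∧ k₂ x = Yc ρ t

theorem IsConvexCurve.exists_isGraphPair {ρ : ℝ → ℝ} (hc : IsConvexCurve ρ) (h : IsStarCurve ρ) :
    ∃ c d a k₁ k₂, IsGraphPair ρ c d a k₁ k₂ := by
  have hpi : (0 : ℝ) ≤ π / 2 := by positivity
  have hu := hc.isUnimodal_Xc h
  obtain ⟨c, hcm, d, hdm, hcd, heq, hmax, hltc, hltd⟩ :=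
    IsUnimodal.exists_max h.continuousOn_Xc hpi
  have hmono := hu.strictMonoOn hcm hltc
  have hanti := hu.strictAntiOn hdm hltd
  have hd : d < π / 2 := by
    refine lt_of_le_of_ne hdm.2 fun he => ?_
    have h1 := hmax 0 ⟨le_rfl, hpi⟩
    rw [heq, he, Xc_pi_div_two] at h1
    exact absurd (h.Xc_pos ⟨le_rfl, by positivity⟩) (not_lt.2 h1)
  have hXc : ContinuousOn (Xc ρ) (Icc 0 c) :=
    h.continuousOn_Xc.mono (Icc_subset_Icc_right hcm.2)
  have hXd : ContinuousOn (Xc ρ) (Icc d (π / 2)) :=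
    h.continuousOn_Xc.mono (Icc_subset_Icc_left hdm.1)
  have hl : (0 : ℝ) ∈ Icc 0 c := ⟨le_rfl, hcm.1⟩
  have hr : π / 2 ∈ Icc d (π / 2) := ⟨hdm.2, le_rfl⟩
  obtain ⟨k₁, hk₁, hk₁X, hk₁e⟩ := exists_continuous_graph
    (hmono.monotoneOn hl ⟨hcm.1, le_rfl⟩ hcm.1) hXc
    (h.continuousOn_Yc.mono (Icc_subset_Icc_right hcm.2)) hmono.injOn
    (Subset.antisymm (image_subset_iff.2 fun t ht =>
      ⟨hmono.monotoneOn hl ht ht.1, hmono.monotoneOn ht ⟨hcm.1, le_rfl⟩ ht.2⟩)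
      (intermediate_value_Icc hcm.1 hXc))
  obtain ⟨k₂, hk₂, hk₂X, hk₂e⟩ := exists_continuous_graph
    (hanti.antitoneOn ⟨le_rfl, hdm.2⟩ hr hdm.2) hXd
    (h.continuousOn_Yc.mono (Icc_subset_Icc_left hdm.1)) hanti.injOn
    (Subset.antisymm (image_subset_iff.2 fun t ht =>
      ⟨hanti.antitoneOn ht hr ht.2, hanti.antitoneOn ⟨le_rfl, hdm.2⟩ ht ht.1⟩)
      (intermediate_value_Icc' hdm.2 hXd))
  refine ⟨c, d, Xc ρ c, k₁, k₂, hcm.1, hcd, hd, fun t ht => ?_, hmax, ?_, hmono, hanti, hk₁, hk₂,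
    hk₁X, hk₂X, hk₁e, ?_⟩
  · exact le_antisymm (hmax t ⟨hcm.1.trans ht.1, ht.2.trans hdm.2⟩)
      (hu.le_of_le hcm hdm ht.1 ht.2 le_rfl heq.le)
  · exact hu.monotoneOn hdm (heq ▸ hmax)
  · simpa only [Xc_pi_div_two, heq] using hk₂e

end Graph

section Mixed

variable {ρ₀ ρ : ℝ → ℝ} {c d a : ℝ} {k₁ k₂ l₁ l₂ : ℝ → ℝ} {c₀ d₀ : ℝ}

namespace IsGraphPair

theorem right_nonneg (G : IsGraphPair ρ c d a k₁ k₂) : 0 ≤ d := G.nonneg.trans G.le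

theorem Xc_left (G : IsGraphPair ρ c d a k₁ k₂) : Xc ρ c = a := G.Xc_eq c ⟨le_rfl, G.le⟩

theorem Xc_right (G : IsGraphPair ρ c d a k₁ k₂) : Xc ρ d = a := G.Xc_eq d ⟨G.le, le_rfl⟩

theorem Xc_zero_le (G : IsGraphPair ρ c d a k₁ k₂) : Xc ρ 0 ≤ a :=
  G.Xc_le 0 ⟨le_rfl, by positivity⟩

theorem pos (G : IsGraphPair ρ c d a k₁ k₂) (h : IsStarCurve ρ) : 0 < a :=
  (h.Xc_pos ⟨le_rfl, by positivity⟩).trans_le G.Xc_zero_le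

theorem lower_eq_zero (G : IsGraphPair ρ c d a k₁ k₂) {x : ℝ} (hx : x ≤ Xc ρ 0) : k₁ x = 0 := by
  obtain ⟨t, ht, hXt, hk⟩ := G.exists_lower x
  rw [max_eq_left ((min_le_right _ _).trans hx)] at hXt
  rw [hk, G.strictMonoOn.injOn ht ⟨le_rfl, G.nonneg⟩ hXt, Yc_zero]

theorem lower_nonneg (G : IsGraphPair ρ c d a k₁ k₂) (h : IsStarCurve ρ) (x : ℝ) : 0 ≤ k₁ x := by
  obtain ⟨t, ht, -, hk⟩ := G.exists_lower x
  rw [hk]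
  exact h.Yc_nonneg ⟨ht.1, ht.2.trans (G.le.trans G.lt.le)⟩

/-- A point of the lower graph lies on the curve. -/
theorem exists_mem_lower (G : IsGraphPair ρ c d a k₁ k₂) {x : ℝ} (hx : x ∈ Icc (Xc ρ 0) a) :
    ∃ t ∈ Icc 0 (π / 2), Xc ρ t = x ∧ Yc ρ t = k₁ x := by
  obtain ⟨t, ht, hXt, hk⟩ := G.exists_lower x
  rw [min_eq_right hx.2, max_eq_right hx.1] at hXt
  exact ⟨t, ⟨ht.1, ht.2.trans (G.le.trans G.lt.le)⟩, hXt, hk.symm⟩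

/-- A point of the upper graph lies on the curve. -/
theorem exists_mem_upper (G : IsGraphPair ρ c d a k₁ k₂) {x : ℝ} (hx : x ∈ Icc 0 a) :
    ∃ t ∈ Icc 0 (π / 2), Xc ρ t = x ∧ Yc ρ t = k₂ x := by
  obtain ⟨t, ht, hXt, hk⟩ := G.exists_upper x
  rw [min_eq_right hx.2, max_eq_right hx.1] at hXt
  exact ⟨t, ⟨G.right_nonneg.trans ht.1, ht.2⟩, hXt, hk.symm⟩

theorem deriv_Xc_nonneg (G : IsGraphPair ρ c d a k₁ k₂) {θ : ℝ} (hθ : θ ∈ Ioo 0 d) :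
    0 ≤ deriv (Xc ρ) θ := by
  rw [← derivWithin_of_mem_nhds (Icc_mem_nhds hθ.1 hθ.2)]
  exact G.monotoneOn.derivWithin_nonneg

theorem deriv_Xc_nonpos (G : IsGraphPair ρ c d a k₁ k₂) {θ : ℝ} (hθ : θ ∈ Ioo d (π / 2)) :
    deriv (Xc ρ) θ ≤ 0 := by
  rw [← derivWithin_of_mem_nhds (Icc_mem_nhds hθ.1 hθ.2)]
  exact G.strictAntiOn.antitoneOn.derivWithin_nonpos

theorem area_eq (G : IsGraphPair ρ c d a k₁ k₂) (h : IsStarCurve ρ) (hc : IsConvexCurve ρ) :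
    area ρ = (∫ x in (0 : ℝ)..a, k₂ x) - ∫ x in (0 : ℝ)..a, k₁ x := by
  have hpi : (0 : ℝ) ≤ π / 2 := by positivity
  have hintegrable : IntervalIntegrable (fun θ => Yc ρ θ * deriv (Xc ρ) θ) volume 0 (π / 2) :=
    (hc.intervalIntegrable_deriv_Xc h).continuousOn_mul (uIcc_of_le hpi ▸ h.continuousOn_Yc)
  have hd : d ∈ uIcc 0 (π / 2) := by rw [uIcc_of_le hpi]; exact ⟨G.right_nonneg, G.lt.le⟩
  have hsplit := intervalIntegral.integral_add_adjacent_intervals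
    (hintegrable.mono_set (uIcc_subset_uIcc_left hd)) (hintegrable.mono_set (uIcc_subset_uIcc_right hd))
  rw [(hc.integral_Xc_mul_deriv_Yc h).2.2] at hsplit
  have h1 : ∫ θ in (0 : ℝ)..d, Yc ρ θ * deriv (Xc ρ) θ = ∫ x in Xc ρ 0..a, k₁ x := by
    rw [← G.Xc_right,
      ← (hc.integral_comp_Xc_mul_deriv h G.continuous_lower le_rfl G.right_nonneg G.lt.le).2]
    refine intervalIntegral.integral_congr_ae ?_
    have hne : ∀ᵐ t : ℝ, t ≠ d := by simp [ae_iff, measure_singleton]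
    filter_upwards [hne] with t htd ht
    rw [uIoc_of_le G.right_nonneg] at ht
    rcases le_or_gt t c with htc | htc
    · rw [G.lower_Xc t ⟨ht.1.le, htc⟩]
    · have : Xc ρ =ᶠ[𝓝 t] fun _ => a := by
        filter_upwards [Ioo_mem_nhds htc (lt_of_le_of_ne ht.2 htd)] with s hs
        exact G.Xc_eq s ⟨hs.1.le, hs.2.le⟩
      rw [this.deriv_eq, deriv_const, mul_zero, mul_zero]
  have h2 : ∫ θ in d..π / 2, Yc ρ θ * deriv (Xc ρ) θ = ∫ x in a..0, k₂ x := by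
    have := (hc.integral_comp_Xc_mul_deriv h G.continuous_upper G.right_nonneg G.lt.le le_rfl).2
    rw [G.Xc_right, Xc_pi_div_two] at this
    rw [← this]
    refine intervalIntegral.integral_congr fun t ht => ?_
    rw [uIcc_of_le G.lt.le] at ht
    simp only [G.upper_Xc t ht]
  have h3 : ∫ x in (0 : ℝ)..Xc ρ 0, k₁ x = 0 := by
    refine intervalIntegral.integral_zero_ae (Eventually.of_forall fun x hx => ?_)
    rw [uIoc_of_le (h.Xc_nonneg ⟨le_rfl, hpi⟩)] at hx
    exact G.lower_eq_zero hx.2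
  have h4 := intervalIntegral.integral_add_adjacent_intervals (a := 0) (b := Xc ρ 0) (c := a)
    (G.continuous_lower.intervalIntegrable (μ := volume) _ _)
    (G.continuous_lower.intervalIntegrable _ _)
  rw [h1, h2, intervalIntegral.integral_symm 0 a] at hsplit
  linarith

theorem le_suppFun_lower (G₀ : IsGraphPair ρ₀ c₀ d₀ a l₁ l₂) (h₀ : IsStarCurve ρ₀) {x u v : ℝ}
    (hx : x ∈ Icc 0 a) (hv : x < Xc ρ₀ 0 → 0 ≤ v) : x * v - l₁ x * u ≤ suppFun ρ₀ u v := by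
  rcases lt_or_ge x (Xc ρ₀ 0) with hlt | hle
  · have := h₀.le_suppFun u v (φ := 0) ⟨le_rfl, by positivity⟩
    rw [Yc_zero] at this
    rw [G₀.lower_eq_zero hlt.le]
    nlinarith [hv hlt]
  · obtain ⟨t, ht, hX, hY⟩ := G₀.exists_mem_lower ⟨hle, hx.2⟩
    rw [← hY]
    exact hX ▸ h₀.le_suppFun u v ht

theorem le_suppFun_upper (G₀ : IsGraphPair ρ₀ c₀ d₀ a l₁ l₂) (h₀ : IsStarCurve ρ₀) {x : ℝ}
    (u v : ℝ) (hx : x ∈ Icc 0 a) : x * v - l₂ x * u ≤ suppFun ρ₀ u v := by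
  obtain ⟨t, ht, hX, hY⟩ := G₀.exists_mem_upper hx
  rw [← hY]
  exact hX ▸ h₀.le_suppFun u v ht

theorem deriv_Yc_pos (G : IsGraphPair ρ c d a k₁ k₂) (h : IsStarCurve ρ) {θ : ℝ}
    (hθ : θ ∈ Ioo 0 d) (hX : DifferentiableAt ℝ (Xc ρ) θ) (hY : DifferentiableAt ℝ (Yc ρ) θ) :
    0 < deriv (Yc ρ) θ := by
  have hm : θ ∈ Ioo 0 (π / 2) := ⟨hθ.1, hθ.2.trans G.lt⟩
  have h1 := wedge_deriv hm hX hY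
  have h2 := G.deriv_Xc_nonneg hθ
  have h3 := h.Xc_pos ⟨hm.1.le, hm.2⟩
  have h4 := h.Yc_nonneg ⟨hm.1.le, hm.2.le⟩
  have h5 := h.2 θ ⟨hm.1.le, hm.2.le⟩
  by_contra! h6
  nlinarith [mul_nonneg h4 h2, mul_nonneg h3.le (neg_nonneg.2 h6)]

end IsGraphPair

/-- The inequality between mixed area and area, with the conditions for equality. -/
theorem area_add_area_le_AwSup (h₀ : IsStarCurve ρ₀) (h : IsStarCurve ρ)
    (hc₀ : IsConvexCurve ρ₀) (hc : IsConvexCurve ρ)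
    (G₀ : IsGraphPair ρ₀ c₀ d₀ a l₁ l₂) (G : IsGraphPair ρ c d a k₁ k₂) :
    area ρ + area ρ₀ ≤ AwSup ρ₀ ρ ∧ (AwSup ρ₀ ρ = area ρ + area ρ₀ →
      (∀ᵐ θ, θ ∈ Ioo 0 d → suppFun ρ₀ (deriv (Xc ρ) θ) (deriv (Yc ρ) θ) =
        Xc ρ θ * deriv (Yc ρ) θ - l₁ (Xc ρ θ) * deriv (Xc ρ) θ) ∧
      (∀ᵐ θ, θ ∈ Ioo d (π / 2) → suppFun ρ₀ (deriv (Xc ρ) θ) (deriv (Yc ρ) θ) =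
        Xc ρ θ * deriv (Yc ρ) θ - l₂ (Xc ρ θ) * deriv (Xc ρ) θ) ∧
      ∫ x in (0 : ℝ)..Xc ρ 0, l₁ x = 0) := by
  have hpi : (0 : ℝ) ≤ π / 2 := by positivity
  have hX0 : 0 ≤ Xc ρ 0 := h.Xc_nonneg ⟨le_rfl, hpi⟩
  have hd : d ∈ uIcc 0 (π / 2) := by rw [uIcc_of_le hpi]; exact ⟨G.right_nonneg, G.lt.le⟩
  have hL : uIcc 0 d ⊆ uIcc 0 (π / 2) := uIcc_subset_uIcc_left hd
  have hR : uIcc d (π / 2) ⊆ uIcc 0 (π / 2) := uIcc_subset_uIcc_right hd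
  have hF := intervalIntegrable_suppFun h₀ h hc
  obtain ⟨hXY, hXYi, -⟩ := hc.integral_Xc_mul_deriv_Yc h
  obtain ⟨hl, hli⟩ :=
    hc.integral_comp_Xc_mul_deriv h G₀.continuous_lower le_rfl G.right_nonneg G.lt.le
  obtain ⟨hu, hui⟩ :=
    hc.integral_comp_Xc_mul_deriv h G₀.continuous_upper G.right_nonneg G.lt.le le_rfl
  have hrl := (hF.mono_set hL).sub ((hXY.mono_set hL).sub hl)
  have hru := (hF.mono_set hR).sub ((hXY.mono_set hR).sub hu)
  have hil := (intervalIntegral.integral_sub (hF.mono_set hL) ((hXY.mono_set hL).sub hl)).trans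
    (congrArg _ (intervalIntegral.integral_sub (hXY.mono_set hL) hl))
  have hiu := (intervalIntegral.integral_sub (hF.mono_set hR) ((hXY.mono_set hR).sub hu)).trans
    (congrArg _ (intervalIntegral.integral_sub (hXY.mono_set hR) hu))
  have hFs := intervalIntegral.integral_add_adjacent_intervals (hF.mono_set hL) (hF.mono_set hR)
  have hXYs :=
    intervalIntegral.integral_add_adjacent_intervals (hXY.mono_set hL) (hXY.mono_set hR)
  rw [← AwSup_eq] at hFs
  rw [hXYi] at hXYs
  have hl4 := intervalIntegral.integral_add_adjacent_intervals (a := 0) (b := Xc ρ 0) (c := a)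
    (G₀.continuous_lower.intervalIntegrable (μ := volume) _ _)
    (G₀.continuous_lower.intervalIntegrable _ _)
  have hA := G₀.area_eq h₀ hc₀
  rw [hli, G.Xc_right] at hil
  rw [hui, G.Xc_right, Xc_pi_div_two, intervalIntegral.integral_symm 0 a] at hiu
  have hnn : 0 ≤ ∫ x in (0 : ℝ)..Xc ρ 0, l₁ x :=
    intervalIntegral.integral_nonneg hX0 fun x _ => G₀.lower_nonneg h₀ x
  have hmem : ∀ t ∈ Ioo 0 (π / 2), Xc ρ t ∈ Icc 0 a := fun t ht =>
    ⟨h.Xc_nonneg ⟨ht.1.le, ht.2.le⟩, G.Xc_le t ⟨ht.1.le, ht.2.le⟩⟩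
  have hposl : 0 ≤ᵐ[volume.restrict (Ioc 0 d)] fun θ =>
      suppFun ρ₀ (deriv (Xc ρ) θ) (deriv (Yc ρ) θ) -
        (Xc ρ θ * deriv (Yc ρ) θ - l₁ (Xc ρ θ) * deriv (Xc ρ) θ) := by
    rw [EventuallyLE, ae_restrict_iff' measurableSet_Ioc]
    have hne : ∀ᵐ t : ℝ, t ≠ d := by simp [ae_iff, measure_singleton]
    filter_upwards [hc.ae_differentiableAt h, hne] with t ht htd htm
    have hm : t ∈ Ioo 0 d := ⟨htm.1, lt_of_le_of_ne htm.2 htd⟩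
    have hm' : t ∈ Ioo 0 (π / 2) := ⟨hm.1, hm.2.trans G.lt⟩
    exact sub_nonneg.2 (G₀.le_suppFun_lower h₀ (hmem t hm')
      fun _ => (G.deriv_Yc_pos h hm (ht hm').1 (ht hm').2).le)
  have hposu : 0 ≤ᵐ[volume.restrict (Ioc d (π / 2))] fun θ =>
      suppFun ρ₀ (deriv (Xc ρ) θ) (deriv (Yc ρ) θ) -
        (Xc ρ θ * deriv (Yc ρ) θ - l₂ (Xc ρ θ) * deriv (Xc ρ) θ) := by
    rw [EventuallyLE, ae_restrict_iff' measurableSet_Ioc]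
    refine Eventually.of_forall fun t ht => ?_
    have hm : t ∈ Icc 0 (π / 2) := ⟨G.right_nonneg.trans ht.1.le, ht.2⟩
    exact sub_nonneg.2 (G₀.le_suppFun_upper h₀ _ _ ⟨h.Xc_nonneg hm, G.Xc_le t hm⟩)
  have hnl := (integral_nonneg_of_ae hposl).trans_eq
    (intervalIntegral.integral_of_le G.right_nonneg).symm
  have hnu := (integral_nonneg_of_ae hposu).trans_eq
    (intervalIntegral.integral_of_le G.lt.le).symm
  refine ⟨by linarith, fun heq => ?_⟩
  have hzl := (intervalIntegral.integral_eq_zero_iff_of_le_of_nonneg_ae G.right_nonneg hposl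
    hrl).1 (by linarith)
  have hzu := (intervalIntegral.integral_eq_zero_iff_of_le_of_nonneg_ae G.lt.le hposu
    hru).1 (by linarith)
  rw [EventuallyEq, ae_restrict_iff' measurableSet_Ioc] at hzl hzu
  refine ⟨?_, ?_, by linarith⟩
  · filter_upwards [hzl] with t ht htm
    exact sub_eq_zero.1 (ht ⟨htm.1, htm.2.le⟩)
  · filter_upwards [hzu] with t ht htm
    exact sub_eq_zero.1 (ht ⟨htm.1, htm.2.le⟩)

end Mixed

section Supergradient

variable {k l : ℝ → ℝ} {c d : ℝ}

/-- Two functions with a common supergradient at densely many points: an increment of `l` is at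
most the preceding increment of `k`. -/
theorem sub_le_sub_of_supergradient (hk : Continuous k) (hl : Continuous l)
    (H : ∀ u v, c ≤ u → u < v → v ≤ d → ∃ x ∈ Ioo u v, ∃ s, ∀ z ∈ Icc c d,
      k z ≤ k x + s * (z - x) ∧ l z ≤ l x + s * (z - x))
    {u m : ℝ} (hm : 0 < m) (hu : c ≤ u) (hd : u + 2 * m ≤ d) :
    l (u + 2 * m) - l (u + m) ≤ k (u + m) - k u := by
  let S : Set ℝ := {x | (l (u + 2 * m) - l x) * (x - u) ≤ (k x - k u) * (u + 2 * m - x)}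
  have hS : IsClosed S := isClosed_le (by fun_prop) (by fun_prop)
  have hmem : u + m ∈ closure S := by
    refine mem_closure_iff_nhds.2 fun t ht => ?_
    obtain ⟨ε, hε, hεt⟩ := Metric.mem_nhds_iff.1 ht
    have hlt : u + m < u + m + min ε m := by linarith [lt_min hε hm]
    have h2 := min_le_right ε m
    obtain ⟨x, hx, s, hs⟩ := H (u + m) (u + m + min ε m) (by linarith) hlt (by linarith)
    refine ⟨x, hεt ?_, ?_⟩
    · rw [Metric.mem_ball, Real.dist_eq, abs_of_pos (sub_pos.2 hx.1)]
      linarith [hx.2, min_le_left ε m]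
    · have h3 := (hs u ⟨hu, by linarith⟩).1
      have h4 := (hs (u + 2 * m) ⟨by linarith, hd⟩).2
      have h5 : 0 ≤ x - u := by linarith [hx.1]
      have h6 : 0 ≤ u + 2 * m - x := by linarith [hx.2]
      change (l (u + 2 * m) - l x) * (x - u) ≤ (k x - k u) * (u + 2 * m - x)
      nlinarith [mul_le_mul_of_nonneg_right h4 h5, mul_le_mul_of_nonneg_right h3 h6]
  rw [hS.closure_eq] at hmem
  have h7 : (l (u + 2 * m) - l (u + m)) * m ≤ (k (u + m) - k u) * m := by
    have : (l (u + 2 * m) - l (u + m)) * (u + m - u) ≤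
      (k (u + m) - k u) * (u + 2 * m - (u + m)) := hmem
    linarith
  exact le_of_mul_le_mul_right h7 hm

theorem increment_le_of_supergradient (hk : Continuous k) (hl : Continuous l)
    (H : ∀ u v, c ≤ u → u < v → v ≤ d → ∃ x ∈ Ioo u v, ∃ s, ∀ z ∈ Icc c d,
      k z ≤ k x + s * (z - x) ∧ l z ≤ l x + s * (z - x))
    {z : ℝ} (hz : z ∈ Icc c d) : l z - l c ≤ k z - k c := by
  rcases hz.1.eq_or_lt with rfl | hlt
  · simp
  have key : ∀ (n : ℕ) {m : ℝ}, 0 < m → c + (n + 1) * m ≤ d →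
      l (c + (n + 1) * m) - l (c + m) ≤ k (c + n * m) - k c := by
    intro n m hm
    induction n with
    | zero => simp
    | succ n ih =>
      intro hle
      push_cast at hle ⊢
      have h1 := ih (by linarith)
      have h2 := sub_le_sub_of_supergradient hk hl H (u := c + n * m) hm
        (by linarith [mul_nonneg n.cast_nonneg hm.le]) (by linarith)
      rw [show c + n * m + 2 * m = c + (n + 1 + 1) * m by ring,
        show c + n * m + m = c + (n + 1) * m by ring] at h2
      linarith
  have hlim : Tendsto (fun n : ℕ => (z - c) * (1 / ((n : ℝ) + 1))) atTop (𝓝 0) := by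
    simpa using tendsto_one_div_add_atTop_nhds_zero_nat.const_mul (z - c)
  have h1 : Tendsto (fun n : ℕ => l z - l (c + (z - c) * (1 / ((n : ℝ) + 1)))) atTop
      (𝓝 (l z - l (c + 0))) :=
    (((hl.tendsto _).comp (tendsto_const_nhds.add hlim))).const_sub _
  have h2 : Tendsto (fun n : ℕ => k (z - (z - c) * (1 / ((n : ℝ) + 1))) - k c) atTop
      (𝓝 (k (z - 0) - k c)) :=
    (((hk.tendsto _).comp (tendsto_const_nhds.sub hlim))).sub_const _
  rw [add_zero] at h1
  rw [sub_zero] at h2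
  refine le_of_tendsto_of_tendsto' h1 h2 fun n => ?_
  have hn : (0 : ℝ) < n + 1 := by positivity
  have he : c + (n + 1) * ((z - c) * (1 / ((n : ℝ) + 1))) = z := by field_simp; ring
  have he' : c + n * ((z - c) * (1 / ((n : ℝ) + 1))) = z - (z - c) * (1 / ((n : ℝ) + 1)) := by
    field_simp; ring
  have := key n (m := (z - c) * (1 / ((n : ℝ) + 1)))
    (mul_pos (sub_pos.2 hlt) (by positivity)) (he.le.trans hz.2)
  rwa [he, he'] at this

/-- Continuous functions with a common supergradient at densely many points differ by a
constant. -/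
theorem sub_eq_sub_of_supergradient (hk : Continuous k) (hl : Continuous l)
    (H : ∀ u v, c ≤ u → u < v → v ≤ d → ∃ x ∈ Ioo u v, ∃ s, ∀ z ∈ Icc c d,
      k z ≤ k x + s * (z - x) ∧ l z ≤ l x + s * (z - x))
    {z : ℝ} (hz : z ∈ Icc c d) : k z - l z = k c - l c := by
  have h1 := increment_le_of_supergradient hk hl H hz
  have h2 := increment_le_of_supergradient hl hk (fun u v hu huv hv => by
    obtain ⟨x, hx, s, hs⟩ := H u v hu huv hv
    exact ⟨x, hx, s, fun z hz => (hs z hz).symm⟩) hz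
  linarith

theorem le_add_div_mul_of_wedge_le {x z A B p q : ℝ} (hp : p < 0)
    (h : z * q - A * p ≤ x * q - B * p) : A ≤ B + q / p * (z - x) := by
  have h1 : q / p * p = q := div_mul_cancel₀ q hp.ne
  by_contra! h2
  have h3 := mul_lt_mul_of_neg_right h2 hp
  have h4 : (B + q / p * (z - x)) * p = B * p + q * (z - x) := by
    linear_combination (z - x) * h1
  linarith

end Supergradient

section Rigidity

variable {ρ₀ ρ : ℝ → ℝ} {c d a : ℝ} {k₁ k₂ l₁ l₂ : ℝ → ℝ} {c₀ d₀ : ℝ}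

theorem upper_sub_eq_const (h₀ : IsStarCurve ρ₀) (h : IsStarCurve ρ) (hc : IsConvexCurve ρ)
    (G₀ : IsGraphPair ρ₀ c₀ d₀ a l₁ l₂) (G : IsGraphPair ρ c d a k₁ k₂)
    (hF : ∀ᵐ θ, θ ∈ Ioo d (π / 2) → suppFun ρ₀ (deriv (Xc ρ) θ) (deriv (Yc ρ) θ) =
        Xc ρ θ * deriv (Yc ρ) θ - l₂ (Xc ρ θ) * deriv (Xc ρ) θ)
    {x : ℝ} (hx : x ∈ Icc 0 a) : k₂ x - l₂ x = k₂ 0 - l₂ 0 := by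
  have hdense := Measure.dense_of_ae (hF.and (hc.ae_differentiableAt h))
  refine sub_eq_sub_of_supergradient G.continuous_upper G₀.continuous_upper
    (fun u v hu huv hv => ?_) hx
  obtain ⟨r, hr, hXr, -⟩ := G.exists_upper u
  obtain ⟨t, ht, hXt, -⟩ := G.exists_upper v
  rw [min_eq_right (huv.le.trans hv), max_eq_right hu] at hXr
  rw [min_eq_right hv, max_eq_right (hu.trans huv.le)] at hXt
  have htr : t < r := (G.strictAntiOn.lt_iff_gt hr ht).1 (by rwa [hXr, hXt])
  obtain ⟨θ, ⟨hθF, hθD⟩, hθ⟩ := hdense.exists_between htr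
  have hm : θ ∈ Ioo d (π / 2) := ⟨ht.1.trans_lt hθ.1, hθ.2.trans_le hr.2⟩
  have hm' : θ ∈ Ioo 0 (π / 2) := ⟨G.right_nonneg.trans_lt hm.1, hm.2⟩
  obtain ⟨hX, hY⟩ := hθD hm'
  have hmc := Ioo_subset_Icc_self hm
  have hXθu : u < Xc ρ θ := hXr ▸ G.strictAntiOn hmc hr hθ.2
  have hXθv : Xc ρ θ < v := hXt ▸ G.strictAntiOn ht hmc hθ.1
  have hneg : deriv (Xc ρ) θ < 0 := by
    refine lt_of_le_of_ne (G.deriv_Xc_nonpos hm) fun h0 => ?_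
    have h1 := hc.wedge_deriv_le hm' (φ := d) ⟨G.right_nonneg, G.lt.le⟩ hX hY
    have h2 := wedge_deriv hm' hX hY
    have h3 := h.2 θ (Ioo_subset_Icc_self hm')
    rw [h0, mul_zero, sub_zero] at h2
    rw [h0, G.Xc_right] at h1
    have h4 : 0 < deriv (Yc ρ) θ := by
      refine pos_of_mul_pos_right (h2 ▸ by positivity) (hu.trans hXθu.le)
    nlinarith
  refine ⟨Xc ρ θ, ⟨hXθu, hXθv⟩, deriv (Yc ρ) θ / deriv (Xc ρ) θ, fun z hz => ⟨?_, ?_⟩⟩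
  · refine le_add_div_mul_of_wedge_le hneg ?_
    obtain ⟨φ, hφ, hXφ, hYφ⟩ := G.exists_mem_upper hz
    have := hc.wedge_deriv_le hm' hφ hX hY
    rwa [hXφ, hYφ, ← G.upper_Xc θ hmc] at this
  · refine le_add_div_mul_of_wedge_le hneg ?_
    rw [← hθF hm]
    exact G₀.le_suppFun_upper h₀ _ _ hz

theorem lower_eq (h₀ : IsStarCurve ρ₀) (h : IsStarCurve ρ) (hc : IsConvexCurve ρ)
    (G₀ : IsGraphPair ρ₀ c₀ d₀ a l₁ l₂) (G : IsGraphPair ρ c d a k₁ k₂)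
    (hF : ∀ᵐ θ, θ ∈ Ioo 0 d → suppFun ρ₀ (deriv (Xc ρ) θ) (deriv (Yc ρ) θ) =
        Xc ρ θ * deriv (Yc ρ) θ - l₁ (Xc ρ θ) * deriv (Xc ρ) θ)
    (hzero : ∫ x in (0 : ℝ)..Xc ρ 0, l₁ x = 0)
    {x : ℝ} (hx : x ∈ Icc 0 a) : k₁ x = l₁ x := by
  have hX0 : 0 < Xc ρ 0 := h.Xc_pos ⟨le_rfl, by positivity⟩
  have hl0 : ∀ z ∈ Icc 0 (Xc ρ 0), l₁ z = 0 := by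
    intro z hz
    by_contra hne
    refine (intervalIntegral.integral_pos hX0 G₀.continuous_lower.continuousOn
      (fun y _ => G₀.lower_nonneg h₀ y)
      ⟨z, hz, lt_of_le_of_ne (G₀.lower_nonneg h₀ z) (Ne.symm hne)⟩).ne' hzero
  rcases le_total x (Xc ρ 0) with hle | hle
  · rw [G.lower_eq_zero hle, hl0 x ⟨hx.1, hle⟩]
  have hdense := Measure.dense_of_ae (hF.and (hc.ae_differentiableAt h))
  have key : -k₁ x - -l₁ x = -k₁ (Xc ρ 0) - -l₁ (Xc ρ 0) := by
    refine sub_eq_sub_of_supergradient (k := fun x => -k₁ x) (l := fun x => -l₁ x) (d := a)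
      G.continuous_lower.neg G₀.continuous_lower.neg (fun u v hu huv hv => ?_) ⟨hle, hx.2⟩
    obtain ⟨r, hr, hXr, -⟩ := G.exists_lower u
    obtain ⟨t, ht, hXt, -⟩ := G.exists_lower v
    rw [min_eq_right (huv.le.trans hv), max_eq_right hu] at hXr
    rw [min_eq_right hv, max_eq_right (hu.trans huv.le)] at hXt
    have hrt : r < t := (G.strictMonoOn.lt_iff_lt hr ht).1 (by rwa [hXr, hXt])
    obtain ⟨θ, ⟨hθF, hθD⟩, hθ⟩ := hdense.exists_between hrt
    have hmc : θ ∈ Icc 0 c := ⟨hr.1.trans hθ.1.le, hθ.2.le.trans ht.2⟩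
    have hm : θ ∈ Ioo 0 d := ⟨hr.1.trans_lt hθ.1, hθ.2.trans_le (ht.2.trans G.le)⟩
    have hm' : θ ∈ Ioo 0 (π / 2) := ⟨hm.1, hm.2.trans G.lt⟩
    obtain ⟨hX, hY⟩ := hθD hm'
    have hXθu : u < Xc ρ θ := hXr ▸ G.strictMonoOn hr hmc hθ.1
    have hXθv : Xc ρ θ < v := hXt ▸ G.strictMonoOn hmc ht hθ.2
    have hYpos := G.deriv_Yc_pos h hm hX hY
    have hpos : -deriv (Xc ρ) θ < 0 := by
      refine neg_lt_zero.2 (lt_of_le_of_ne (G.deriv_Xc_nonneg hm) fun h0 => ?_)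
      have h1 := hc.wedge_deriv_le hm' (φ := d) ⟨G.right_nonneg, G.lt.le⟩ hX hY
      rw [← h0, G.Xc_right] at h1
      nlinarith
    refine ⟨Xc ρ θ, ⟨hXθu, hXθv⟩, deriv (Yc ρ) θ / -deriv (Xc ρ) θ, fun z hz => ⟨?_, ?_⟩⟩
    · refine le_add_div_mul_of_wedge_le hpos ?_
      obtain ⟨φ, hφ, hXφ, hYφ⟩ := G.exists_mem_lower hz
      have := hc.wedge_deriv_le hm' hφ hX hY
      rw [hXφ, hYφ, ← G.lower_Xc θ hmc] at this
      rwa [neg_mul_neg, neg_mul_neg]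
    · refine le_add_div_mul_of_wedge_le hpos ?_
      rw [neg_mul_neg, neg_mul_neg, ← hθF hm]
      exact G₀.le_suppFun_lower h₀ ⟨hX0.le.trans hz.1, hz.2⟩ fun _ => hYpos.le
  rw [G.lower_eq_zero le_rfl, hl0 _ ⟨hX0.le, le_rfl⟩] at key
  linarith

/-- The curve is determined by its two graphs. -/
theorem IsGraphPair.eqOn (h₀ : IsStarCurve ρ₀) (h : IsStarCurve ρ) (hc₀ : IsConvexCurve ρ₀)
    (G₀ : IsGraphPair ρ₀ c₀ d₀ a l₁ l₂) (G : IsGraphPair ρ c d a k₁ k₂)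
    (hlow : ∀ x ∈ Icc 0 a, k₁ x = l₁ x) (hup : ∀ x ∈ Icc 0 a, k₂ x = l₂ x) :
    EqOn ρ ρ₀ (Icc 0 (π / 2)) := by
  have hpi : (0 : ℝ) < π / 2 := by positivity
  have hmem : ∀ θ ∈ Icc 0 (π / 2), Xc ρ θ ∈ Icc 0 a := fun θ hθ => ⟨h.Xc_nonneg hθ, G.Xc_le θ hθ⟩
  have hupper : ∀ θ ∈ Icc d (π / 2), Xc ρ₀ θ = Xc ρ θ := by
    intro θ hθ
    have hm : θ ∈ Icc 0 (π / 2) := ⟨G.right_nonneg.trans hθ.1, hθ.2⟩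
    obtain ⟨t, ht, hXt, hYt⟩ := G₀.exists_mem_upper (hmem θ hm)
    rw [← hup _ (hmem θ hm), G.upper_Xc θ hθ] at hYt
    rwa [polar_injective h₀ h ht hm hXt hYt] at hXt
  have hlower : ∀ θ ∈ Icc 0 c, Xc ρ₀ 0 ≤ Xc ρ θ → Xc ρ₀ θ = Xc ρ θ := by
    intro θ hθ hle
    have hm : θ ∈ Icc 0 (π / 2) := ⟨hθ.1, hθ.2.trans (G.le.trans G.lt.le)⟩
    obtain ⟨t, ht, hXt, hYt⟩ := G₀.exists_mem_lower ⟨hle, (hmem θ hm).2⟩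
    rw [← hlow _ (hmem θ hm), G.lower_Xc θ hθ] at hYt
    rwa [polar_injective h₀ h ht hm hXt hYt] at hXt
  have hXeq : EqOn (Xc ρ₀) (Xc ρ) (Ioo 0 (π / 2)) := by
    intro θ hθ
    rcases le_total θ c with hc' | hc'
    · refine hlower θ ⟨hθ.1.le, hc'⟩ (le_of_not_gt fun hlt => ?_)
      have hm := Ioo_subset_Icc_self hθ
      have := hlow _ (hmem θ hm)
      rw [G.lower_Xc θ ⟨hθ.1.le, hc'⟩, G₀.lower_eq_zero hlt.le] at this
      exact (h.Yc_pos ⟨hθ.1, hm.2⟩).ne' this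
    rcases le_total d θ with hd' | hd'
    · exact hupper θ ⟨hd', hθ.2.le⟩
    rw [G.Xc_eq θ ⟨hc', hd'⟩]
    refine le_antisymm (G₀.Xc_le θ (Ioo_subset_Icc_self hθ))
      ((hc₀.isUnimodal_Xc h₀).le_of_le ⟨G.nonneg, G.le.trans G.lt.le⟩
        ⟨G.right_nonneg, G.lt.le⟩ hc' hd' ?_ ?_)
    · rw [hlower c ⟨G.nonneg, le_rfl⟩ (G.Xc_left ▸ G₀.Xc_zero_le), G.Xc_left]
    · rw [hupper d ⟨le_rfl, G.lt.le⟩, G.Xc_right]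
  have heq : EqOn ρ ρ₀ (Ioo 0 (π / 2)) := fun θ hθ =>
    eq_of_Xc_eq ⟨hθ.1.le, hθ.2⟩ (hXeq hθ).symm
  exact heq.of_subset_closure h.1 h₀.1 Ioo_subset_Icc_self (closure_Ioo hpi.ne).ge

end Rigidity

section Scaling

variable {ρ₀ ρ : ℝ → ℝ} {t : ℝ}

theorem eqOn_of_AwSup_eq {c d a c₀ d₀ : ℝ} {k₁ k₂ l₁ l₂ : ℝ → ℝ}
    (h₀ : IsStarCurve ρ₀) (h : IsStarCurve ρ) (hc₀ : IsConvexCurve ρ₀) (hc : IsConvexCurve ρ)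
    (G₀ : IsGraphPair ρ₀ c₀ d₀ a l₁ l₂) (G : IsGraphPair ρ c d a k₁ k₂)
    (hA : area ρ = area ρ₀) (heq : AwSup ρ₀ ρ = area ρ + area ρ₀) :
    EqOn ρ ρ₀ (Icc 0 (π / 2)) := by
  obtain ⟨hl, hu, hzero⟩ := (area_add_area_le_AwSup h₀ h hc₀ hc G₀ G).2 heq
  have hlow : ∀ x ∈ Icc 0 a, k₁ x = l₁ x := fun x hx => lower_eq h₀ h hc G₀ G hl hzero hx
  have hup : ∀ x ∈ Icc 0 a, k₂ x - l₂ x = k₂ 0 - l₂ 0 := fun x hx =>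
    upper_sub_eq_const h₀ h hc G₀ G hu hx
  refine IsGraphPair.eqOn h₀ h hc₀ G₀ G hlow fun x hx => ?_
  have ha := G.pos h
  have h1 : ∫ x in (0 : ℝ)..a, k₁ x = ∫ x in (0 : ℝ)..a, l₁ x :=
    intervalIntegral.integral_congr fun x hx => hlow x (by rwa [uIcc_of_le ha.le] at hx)
  have h2 : ∫ x in (0 : ℝ)..a, (k₂ x - l₂ x) = a * (k₂ 0 - l₂ 0) := by
    rw [intervalIntegral.integral_congr fun x hx => hup x (by rwa [uIcc_of_le ha.le] at hx)]
    simp only [intervalIntegral.integral_const, sub_zero, smul_eq_mul]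
  rw [intervalIntegral.integral_sub (G.continuous_upper.intervalIntegrable _ _)
    (G₀.continuous_upper.intervalIntegrable _ _)] at h2
  rw [G.area_eq h hc, G₀.area_eq h₀ hc₀] at hA
  have h3 : k₂ 0 - l₂ 0 = 0 := by
    refine (mul_eq_zero.1 (?_ : a * (k₂ 0 - l₂ 0) = 0)).resolve_left ha.ne'
    linarith
  linarith [hup x hx]

theorem Xc_const_mul (t : ℝ) (ρ : ℝ → ℝ) (θ : ℝ) : Xc (fun θ => t * ρ θ) θ = t * Xc ρ θ :=
  mul_assoc _ _ _

theorem Yc_const_mul (t : ℝ) (ρ : ℝ → ℝ) (θ : ℝ) : Yc (fun θ => t * ρ θ) θ = t * Yc ρ θ :=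
  mul_assoc _ _ _

theorem IsStarCurve.const_mul (h : IsStarCurve ρ) (ht : 0 < t) :
    IsStarCurve fun θ => t * ρ θ :=
  ⟨h.1.const_mul t, fun θ hθ => mul_pos ht (h.2 θ hθ)⟩

theorem IsConvexCurve.const_mul (hc : IsConvexCurve ρ) (t : ℝ) :
    IsConvexCurve fun θ => t * ρ θ := by
  intro r hr s hs u hu hrs hsu
  simp only [Xc_const_mul, Yc_const_mul]
  have := mul_nonneg (sq_nonneg t) (hc r hr s hs u hu hrs hsu)
  linarith

theorem area_const_mul (t : ℝ) (ρ : ℝ → ℝ) : area (fun θ => t * ρ θ) = t ^ 2 * area ρ := by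
  rw [area, area, ← intervalIntegral.integral_const_mul]
  congr 1; ext θ; ring

theorem AwSup_const_mul_left (ht : 0 ≤ t) (ρ₀ ρ : ℝ → ℝ) :
    AwSup (fun θ => t * ρ₀ θ) ρ = t * AwSup ρ₀ ρ := by
  rw [AwSup, AwSup, ← intervalIntegral.integral_const_mul]
  congr 1; ext θ
  rw [Real.mul_iSup_of_nonneg ht]
  simp only [Xc_const_mul, Yc_const_mul, mul_sub, mul_assoc]

theorem AwSup_congr_left {ρ₁ : ℝ → ℝ} (heq : EqOn ρ₀ ρ₁ (Icc 0 (π / 2))) (ρ : ℝ → ℝ) :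
    AwSup ρ₀ ρ = AwSup ρ₁ ρ := by
  simp only [AwSup, Xc, Yc, heq (Subtype.prop _)]

theorem area_congr {ρ₁ : ℝ → ℝ} (heq : EqOn ρ₀ ρ₁ (Icc 0 (π / 2))) : area ρ₀ = area ρ₁ := by
  refine intervalIntegral.integral_congr fun θ hθ => ?_
  rw [uIcc_of_le (by positivity)] at hθ
  simp only [heq hθ]

/-- Some multiple of `ρ₀` has the same greatest abscissa as `ρ`. -/
theorem exists_isGraphPair_const_mul (h₀ : IsStarCurve ρ₀) (h : IsStarCurve ρ)
    (hc₀ : IsConvexCurve ρ₀) (hc : IsConvexCurve ρ) :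
    ∃ t, 0 < t ∧ ∃ c d a k₁ k₂ c₀ d₀ l₁ l₂, IsGraphPair ρ c d a k₁ k₂ ∧
      IsGraphPair (fun θ => t * ρ₀ θ) c₀ d₀ a l₁ l₂ := by
  obtain ⟨c, d, a, k₁, k₂, G⟩ := hc.exists_isGraphPair h
  obtain ⟨_, s, b, _, _, G₀⟩ := hc₀.exists_isGraphPair h₀
  have ht : 0 < a / b := div_pos (G.pos h) (G₀.pos h₀)
  obtain ⟨c₀, d₀, a', l₁, l₂, G₁⟩ := (hc₀.const_mul (a / b)).exists_isGraphPair (h₀.const_mul ht)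
  have hab : a / b * b = a := div_mul_cancel₀ a (G₀.pos h₀).ne'
  have : a' = a := by
    refine le_antisymm ?_ ?_
    · rw [← G₁.Xc_right, Xc_const_mul]
      exact (mul_le_mul_of_nonneg_left (G₀.Xc_le d₀ ⟨G₁.right_nonneg, G₁.lt.le⟩) ht.le).trans_eq hab
    · have := G₁.Xc_le s ⟨G₀.right_nonneg, G₀.lt.le⟩
      rwa [Xc_const_mul, G₀.Xc_right, hab] at this
  exact ⟨a / b, ht, c, d, a, k₁, k₂, c₀, d₀, l₁, l₂, G, this ▸ G₁⟩

end Scaling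

/-- Lemma 6.5 (generalized isoperimetric inequality, convex case): for continuous,
convex, complete star-shaped curves `γ₀, γ`,
`A_{γ₀}(γ)/√A(γ) ≥ A_{γ₀}(γ₀)/√A(γ₀)`, with equality iff `γ = c γ₀`, `c > 0`. -/
theorem stmt_5 (ρ₀ ρ : ℝ → ℝ)
    (h₀ : IsStarCurve ρ₀) (h : IsStarCurve ρ)
    (hc₀ : IsConvexCurve ρ₀) (hc : IsConvexCurve ρ) :
    AwSup ρ₀ ρ₀ / Real.sqrt (area ρ₀) ≤ AwSup ρ₀ ρ / Real.sqrt (area ρ) ∧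
    (AwSup ρ₀ ρ / Real.sqrt (area ρ) = AwSup ρ₀ ρ₀ / Real.sqrt (area ρ₀) ↔
      ∃ c : ℝ, 0 < c ∧ ∀ θ ∈ Set.Icc (0:ℝ) (π / 2), ρ θ = c * ρ₀ θ) := by
  have hA := h.area_pos
  have hA₀ := h₀.area_pos
  have hs := Real.sqrt_pos.2 hA
  have hs₀ := Real.sqrt_pos.2 hA₀
  have hss := Real.mul_self_sqrt hA.le
  have hss₀ := Real.mul_self_sqrt hA₀.le
  have hself : AwSup ρ₀ ρ₀ / Real.sqrt (area ρ₀) = 2 * Real.sqrt (area ρ₀) := by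
    rw [hc₀.AwSup_self h₀, div_eq_iff hs₀.ne']
    linarith
  obtain ⟨t, ht, c, d, a, k₁, k₂, c₀, d₀, l₁, l₂, G, G₁⟩ :=
    exists_isGraphPair_const_mul h₀ h hc₀ hc
  have h₁ := h₀.const_mul ht
  have hc₁ := hc₀.const_mul t
  have hle := (area_add_area_le_AwSup h₁ h hc₁ hc G₁ G).1
  rw [AwSup_const_mul_left ht.le, area_const_mul] at hle
  rw [hself]
  refine ⟨?_, fun heq => ?_, ?_⟩
  · rw [le_div_iff₀ hs]
    refine le_of_mul_le_mul_left ?_ ht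
    nlinarith [sq_nonneg (Real.sqrt (area ρ) - t * Real.sqrt (area ρ₀))]
  · rw [div_eq_iff hs.ne'] at heq
    have hsq : (Real.sqrt (area ρ) - t * Real.sqrt (area ρ₀)) ^ 2 ≤ 0 := by
      rw [heq] at hle
      nlinarith
    have hsqrt : Real.sqrt (area ρ) = t * Real.sqrt (area ρ₀) :=
      sub_eq_zero.1 (pow_eq_zero_iff two_ne_zero |>.1 (le_antisymm hsq (sq_nonneg _)))
    have harea : area ρ = t ^ 2 * area ρ₀ := by
      rw [← hss, ← hss₀, hsqrt]
      ring
    refine ⟨t, ht, eqOn_of_AwSup_eq h₁ h hc₁ hc G₁ G ?_ ?_⟩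
    · rw [area_const_mul, harea]
    · rw [AwSup_const_mul_left ht.le, area_const_mul, heq, hsqrt, harea]
      linear_combination 2 * t ^ 2 * hss₀
  · rintro ⟨r, hr, heq⟩
    have h1 : r * AwSup ρ₀ ρ = 2 * area ρ := by
      rw [← AwSup_const_mul_left hr.le, ← AwSup_congr_left heq, hc.AwSup_self h]
    have h2 : area ρ = r ^ 2 * area ρ₀ := by rw [area_congr heq, area_const_mul]
    have h3 : Real.sqrt (area ρ) = r * Real.sqrt (area ρ₀) := by
      rw [h2, Real.sqrt_mul (sq_nonneg r), Real.sqrt_sq hr.le]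
    rw [div_eq_iff hs.ne']
    refine mul_left_cancel₀ hr.ne' ?_
    rw [h1, h3, h2]
    linear_combination -2 * r ^ 2 * hss₀
end

section
/- Let λ = x dy + dz be the standard contact form on ℝ³. For a smooth function h on ℝ³ supported in a neighborhood U of the origin (with (0,0,±1) ∉ U) and vanishing to second order along the z-axis (h(0,0,z)=0 and dh(0,0,z)=0 for all z), the derivative at f = 0 of the map f ↦ A(f) (where A(f) is the linearized time-2 Reeb flow map of e^f λ from ξ_{(0,0,−1)} to ξ_{(0,0,1)}) is given by (dA)₀(h) = ∫_{−1}^{1} [[∂_{xy}h, ∂_{yy}h], [−∂_{xx}h, −∂_{xy}h]](0,0,t) dt. Consequently, the map A is submersive at 0 onto the space of linear symplectic maps {φ ∈ Hom(ξ_{(0,0,−1)}, ξ_{(0,0,1)}) : φ*dλ = dλ}. -/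
open Real intervalIntegral

/-- Points of `ℝ³` with coordinates `(x, y, z)`. -/
abbrev P3 : Type := ℝ × ℝ × ℝ

/-- The Reeb vector field of `e^f λ` for the standard contact form `λ = x dy + dz`:
`R_{e^f λ} = e^{-f} (R_λ - X_{df})`, which in coordinates is
`e^{-f} (f_y - x f_z, -f_x, 1 + x f_x)`. -/
noncomputable def reebField (f : P3 → ℝ) (p : P3) : P3 :=
  Real.exp (-f p) •
    ((fderiv ℝ f p (0, 1, 0) - p.1 * fderiv ℝ f p (0, 0, 1),
      -(fderiv ℝ f p (1, 0, 0)),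
      1 + p.1 * fderiv ℝ f p (1, 0, 0)) : P3)

/-- Second partial derivative of `h` at `p` in directions `u, w`. -/
noncomputable def D2 (h : P3 → ℝ) (p : P3) (u w : P3) : ℝ :=
  fderiv ℝ (fun q => fderiv ℝ h q u) p w

/-- `h ∈ F_U`: smooth, supported in `U`, vanishing to second order along the z-axis. -/
def Admissible (U : Set P3) (h : P3 → ℝ) : Prop :=
  ContDiff ℝ (⊤ : ℕ∞) h ∧ tsupport h ⊆ U ∧
    (∀ z : ℝ, h (0, 0, z) = 0) ∧ (∀ z : ℝ, fderiv ℝ h (0, 0, z) = 0)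

section FirstVariation

open Set Metric Filter Topology Asymptotics

variable {E : Type*} [NormedAddCommGroup E] [NormedSpace ℝ E]

lemma hasDerivAt_zero_of_norm_sub_le_sq {f : ℝ → E} {v : E} {K δ : ℝ} (hδ : 0 < δ)
    (h : ∀ ε : ℝ, |ε| ≤ δ → ‖f ε - f 0 - ε • v‖ ≤ K * ε ^ 2) : HasDerivAt f v 0 := by
  rw [hasDerivAt_iff_isLittleO]
  have hO : (fun ε : ℝ => f ε - f 0 - (ε - 0) • v) =O[𝓝 0] fun ε : ℝ => ε ^ 2 := by
    refine IsBigO.of_bound K ?_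
    filter_upwards [Metric.closedBall_mem_nhds (0 : ℝ) hδ] with ε hε
    rw [mem_closedBall, dist_zero_right, Real.norm_eq_abs] at hε
    simpa using h ε hε
  simpa using hO.trans_isLittleO (isLittleO_pow_id (𝕜 := ℝ) one_lt_two)

lemma exists_norm_sub_smul_fderiv_le [FiniteDimensional ℝ E] {F : ℝ × E → E}
    (hF : ContDiff ℝ 2 F) {e : E} (h0 : ∀ q, F (0, q) = e) (p : E) {R : ℝ} (hR : 1 ≤ R) :
    ∃ L : ℝ, 0 ≤ L ∧ ∀ ε : ℝ, |ε| ≤ 1 → ∀ q ∈ closedBall p R, ∀ q' ∈ closedBall p R,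
      ‖F (ε, q) - e - ε • fderiv ℝ F (0, q') (1, 0)‖ ≤ L * (|ε| + ‖q - q'‖) * |ε| := by
  have hP : ContDiff ℝ 1 (fun a : ℝ × E => fderiv ℝ F a (1, 0)) :=
    (hF.fderiv_right (m := 1) (by norm_num)).clm_apply contDiff_const
  obtain ⟨L, hL⟩ := hP.contDiffOn.exists_lipschitzOnWith one_ne_zero
    (convex_closedBall ((0 : ℝ), p) R) (isCompact_closedBall _ _)
  refine ⟨L, L.2, fun ε hε q hq q' hq' => ?_⟩
  have hmem : ∀ r : ℝ, |r| ≤ |ε| → ∀ x ∈ closedBall p R, (r, x) ∈ closedBall ((0 : ℝ), p) R := by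
    intro r hr x hx
    rw [← closedBall_prod_same]
    exact ⟨by simpa using hr.trans (hε.trans hR), hx⟩
  have hder : ∀ r ∈ closedBall (0 : ℝ) |ε|, HasDerivWithinAt
      (fun r : ℝ => F (r, q) - r • fderiv ℝ F (0, q') (1, 0))
      (fderiv ℝ F (r, q) (1, 0) - fderiv ℝ F (0, q') (1, 0)) (closedBall (0 : ℝ) |ε|) r := by
    intro r _
    have h1 : HasDerivAt (fun r : ℝ => (r, q)) ((1 : ℝ), (0 : E)) r :=
      (hasDerivAt_id r).prodMk (hasDerivAt_const r q)
    have h2 := ((hF.differentiable two_ne_zero) (r, q)).hasFDerivAt.comp_hasDerivAt r h1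
    have h3 := (hasDerivAt_id r).smul_const (fderiv ℝ F (0, q') (1, 0))
    rw [one_smul] at h3
    exact (h2.sub h3).hasDerivWithinAt
  have hbound : ∀ r ∈ closedBall (0 : ℝ) |ε|,
      ‖fderiv ℝ F (r, q) (1, 0) - fderiv ℝ F (0, q') (1, 0)‖ ≤ L * (|ε| + ‖q - q'‖) := by
    intro r hr
    have hr' : |r| ≤ |ε| := by simpa using hr
    have := hL.dist_le_mul _ (hmem r hr' q hq) _ (hmem 0 (by simp) q' hq')
    rw [dist_eq_norm] at this
    refine this.trans (mul_le_mul_of_nonneg_left ?_ L.2)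
    rw [Prod.dist_eq, dist_eq_norm q q', dist_zero_right, Real.norm_eq_abs]
    exact max_le (hr'.trans (le_add_of_nonneg_right (norm_nonneg _)))
      (le_add_of_nonneg_left (abs_nonneg _))
  have := (convex_closedBall (0 : ℝ) |ε|).norm_image_sub_le_of_norm_hasDerivWithin_le hder hbound
    (mem_closedBall_self (abs_nonneg ε)) (show ε ∈ closedBall (0 : ℝ) |ε| by simp)
  simpa [h0, sub_right_comm] using this

/-- First variation of the time-`T` map of a family of vector fields that is constant at
parameter `0`. -/
lemma hasDerivAt_flow_of_const [FiniteDimensional ℝ E] {F : ℝ × E → E}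
    (hF : ContDiff ℝ 2 F) {e : E} (h0 : ∀ q, F (0, q) = e) {T : ℝ} (hT : 0 ≤ T) (p : E)
    {γ : ℝ → ℝ → E} (hγ0 : ∀ ε, γ ε 0 = p)
    (hγ : ∀ ε t, HasDerivAt (γ ε) (F (ε, γ ε t)) t) :
    HasDerivAt (fun ε => γ ε T) (∫ s in (0 : ℝ)..T, fderiv ℝ F (0, p + s • e) (1, 0)) 0 := by
  set R : ℝ := 1 + T * ‖e‖ with hRdef
  have hR : 1 ≤ R := le_add_of_nonneg_right (by positivity)
  have hR0 : 0 ≤ R := by linarith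
  obtain ⟨C₀, hC₀⟩ := (hF.contDiffOn (s := closedBall ((0 : ℝ), p) R)).exists_lipschitzOnWith
    two_ne_zero (convex_closedBall ((0 : ℝ), p) R) (isCompact_closedBall _ _)
  obtain ⟨L, hL0, hL⟩ := exists_norm_sub_smul_fderiv_le hF h0 p hR
  set C : ℝ := C₀ + 1 with hCdef
  have hC0 : 0 ≤ C := by positivity
  have hspeed : ∀ ε : ℝ, |ε| ≤ 1 → ∀ q ∈ closedBall p R, ‖F (ε, q) - e‖ ≤ C₀ * |ε| := by
    intro ε hε q hq
    have := hC₀.dist_le_mul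
      (ε, q) (by rw [← closedBall_prod_same]; exact ⟨by simpa using hε.trans hR, hq⟩)
      (0, q) (by rw [← closedBall_prod_same]; exact ⟨by simpa using hR0, hq⟩)
    simpa [dist_eq_norm, h0, Prod.norm_def] using this
  have hline : ∀ s ∈ Icc (0 : ℝ) T, p + s • e ∈ closedBall p R := by
    intro s hs
    rw [mem_closedBall, dist_eq_norm, add_sub_cancel_left, norm_smul, Real.norm_of_nonneg hs.1]
    nlinarith [mul_le_mul_of_nonneg_right hs.2 (norm_nonneg e)]
  have hball : ∀ s ∈ Icc (0 : ℝ) T, ∀ q, ‖q - (p + s • e)‖ ≤ 1 → q ∈ closedBall p R := by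
    intro s hs q hq
    rw [mem_closedBall, dist_eq_norm]
    have h1 : q - p = (q - (p + s • e)) + s • e := by abel
    rw [h1]
    refine (norm_add_le _ _).trans ?_
    rw [norm_smul, Real.norm_of_nonneg hs.1]
    nlinarith [mul_le_mul_of_nonneg_right hs.2 (norm_nonneg e)]
  have hlder : ∀ s : ℝ, HasDerivAt (fun s : ℝ => p + s • e) e s := fun s => by
    simpa using ((hasDerivAt_id s).smul_const e).const_add p
  set δ : ℝ := 1 / (1 + C * T) with hδdef
  have hden : 0 < 1 + C * T := by positivity
  have hδ : 0 < δ := by positivity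
  have hδ1 : δ ≤ 1 := by
    rw [hδdef, div_le_one hden]
    exact le_add_of_nonneg_right (by positivity)
  have hδC : ∀ ε : ℝ, |ε| ≤ δ → ∀ s ∈ Icc (0 : ℝ) T, C * |ε| * s ≤ 1 := by
    intro ε hε s hs
    rw [hδdef, le_div_iff₀ hden] at hε
    have : C * |ε| * s ≤ C * |ε| * T := by gcongr; exact hs.2
    nlinarith [abs_nonneg ε]
  have hclose : ∀ ε : ℝ, |ε| ≤ δ → ∀ s ∈ Icc (0 : ℝ) T,
      ‖γ ε s - (p + s • e)‖ ≤ C * |ε| * s := by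
    intro ε hε
    have hB : ∀ s, HasDerivAt (fun s => C * |ε| * s) (C * |ε|) s :=
      fun s => by simpa using (hasDerivAt_id s).const_mul (C * |ε|)
    have hd : ∀ s, HasDerivAt (fun s => γ ε s - (p + s • e)) (F (ε, γ ε s) - e) s :=
      fun s => (hγ ε s).sub (hlder s)
    have hcont : ContinuousOn (fun s => γ ε s - (p + s • e)) (Icc 0 T) :=
      fun s _ => (hd s).continuousAt.continuousWithinAt
    rcases eq_or_ne ε 0 with rfl | hε0
    · exact fun s hs => image_norm_le_of_norm_deriv_right_le_deriv_boundary hcont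
        (fun s _ => (hd s).hasDerivWithinAt) (by simp [hγ0]) hB (fun s _ => by simp [h0]) hs
    · refine fun s hs => image_norm_le_of_norm_deriv_right_lt_deriv_boundary hcont
        (fun s _ => (hd s).hasDerivWithinAt) (by simp [hγ0]) hB (fun s hs hs' => ?_) hs
      have hs'' := Ico_subset_Icc_self hs
      have hlt : C₀ * |ε| < C * |ε| :=
        mul_lt_mul_of_pos_right (lt_add_one _) (abs_pos.2 hε0)
      exact (hspeed ε (hε.trans hδ1) _
        (hball s hs'' _ (hs'.le.trans (hδC ε hε s hs'')))).trans_lt hlt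
  have hPc : Continuous (fun s : ℝ => fderiv ℝ F (0, p + s • e) (1, 0)) :=
    ((hF.continuous_fderiv two_ne_zero).comp (by fun_prop)).clm_apply continuous_const
  refine hasDerivAt_zero_of_norm_sub_le_sq (K := L * (1 + C * T) * T) hδ fun ε hε => ?_
  have hzero : γ 0 T = p + T • e := by
    have := hclose 0 (by simpa using hδ.le) T ⟨hT, le_rfl⟩
    simpa [sub_eq_zero] using this
  have hd : ∀ s, HasDerivAt
      (fun s => γ ε s - (p + s • e) - ε • ∫ r in (0 : ℝ)..s, fderiv ℝ F (0, p + r • e) (1, 0))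
      (F (ε, γ ε s) - e - ε • fderiv ℝ F (0, p + s • e) (1, 0)) s := fun s =>
    ((hγ ε s).sub (hlder s)).sub
      ((intervalIntegral.integral_hasDerivAt_right (hPc.intervalIntegrable _ _)
        hPc.stronglyMeasurable.stronglyMeasurableAtFilter hPc.continuousAt).const_smul ε)
  have := norm_image_sub_le_of_norm_deriv_le_segment' (a := 0) (b := T)
    (C := L * (1 + C * T) * ε ^ 2) (fun s _ => (hd s).hasDerivWithinAt)
    (fun s hs => by
      have hs' := Ico_subset_Icc_self hs
      have h1 := hclose ε hε s hs'
      refine (hL ε (hε.trans hδ1) _ (hball s hs' _ (h1.trans (hδC ε hε s hs'))) _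
        (hline s hs')).trans ?_
      have h2 : ‖γ ε s - (p + s • e)‖ ≤ C * |ε| * T := h1.trans (by gcongr; exact hs'.2)
      calc L * (|ε| + ‖γ ε s - (p + s • e)‖) * |ε| ≤ L * (|ε| + C * |ε| * T) * |ε| := by gcongr
        _ = L * (1 + C * T) * |ε| ^ 2 := by ring
        _ = L * (1 + C * T) * ε ^ 2 := by rw [sq_abs]) T ⟨hT, le_rfl⟩
  simp only [hγ0, zero_smul, add_zero, sub_self, intervalIntegral.integral_same, smul_zero,
    sub_zero] at this
  rw [hzero]
  exact this.trans_eq (by ring)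

lemma hasFDerivAt_integral_along_line [FiniteDimensional ℝ E] {G : Type*}
    [NormedAddCommGroup G] [NormedSpace ℝ G] {W : E → G}
    (hW : ContDiff ℝ 1 W) (e p : E) (T : ℝ) :
    HasFDerivAt (fun p => ∫ s in (0 : ℝ)..T, W (p + s • e))
      (∫ s in (0 : ℝ)..T, fderiv ℝ W (p + s • e)) p := by
  have hdc := hW.continuous_fderiv one_ne_zero
  have hcomp : IsCompact ((fun a : E × ℝ => a.1 + a.2 • e) '' (closedBall p 1 ×ˢ uIcc 0 T)) :=
    ((isCompact_closedBall p 1).prod isCompact_uIcc).image (by fun_prop)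
  obtain ⟨M, hM⟩ := hcomp.exists_bound_of_continuousOn hdc.continuousOn
  have hWc : ∀ q, Continuous fun s : ℝ => W (q + s • e) :=
    fun q => hW.continuous.comp (by fun_prop)
  have hdc' : Continuous fun s : ℝ => fderiv ℝ W (p + s • e) := hdc.comp (by fun_prop)
  refine intervalIntegral.hasFDerivAt_integral_of_dominated_of_fderiv_le
    (F' := fun q s => fderiv ℝ W (q + s • e)) (bound := fun _ => M)
    (closedBall_mem_nhds p one_pos) (.of_forall fun q => (hWc q).aestronglyMeasurable)
    ((hWc p).intervalIntegrable _ _) hdc'.aestronglyMeasurable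
    (.of_forall fun s hs q hq => hM _ ⟨(q, s), ⟨hq, uIoc_subset_uIcc hs⟩, rfl⟩)
    intervalIntegrable_const (.of_forall fun s _ q _ => ?_)
  exact (hasFDerivAt_comp_add_right (s • e)).2
    (hW.differentiable one_ne_zero (q + s • e)).hasFDerivAt

/-- Exchange of a parameter derivative with a spatial derivative. -/
lemma hasDerivAt_fderiv_apply_of_contDiff {G : Type*} [NormedAddCommGroup G] [NormedSpace ℝ G]
    {Ψ : ℝ × E → G} (hΨ : ContDiff ℝ 2 Ψ) {V : E → G} {V' : E →L[ℝ] G} {p : E}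
    (hV : ∀ q, HasDerivAt (fun ε => Ψ (ε, q)) (V q) 0) (hV' : HasFDerivAt V V' p) (u : E) :
    HasDerivAt (fun ε => fderiv ℝ (fun q => Ψ (ε, q)) p u) (V' u) 0 := by
  have hd : ∀ a, HasFDerivAt Ψ (fderiv ℝ Ψ a) a :=
    fun a => (hΨ.differentiable two_ne_zero a).hasFDerivAt
  have hdd : HasFDerivAt (fderiv ℝ Ψ) (fderiv ℝ (fderiv ℝ Ψ) (0, p)) (0, p) :=
    ((hΨ.fderiv_right (m := 1) (by norm_num)).differentiable one_ne_zero _).hasFDerivAt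
  have hspace : ∀ (ε : ℝ) (q : E), HasFDerivAt (fun q : E => (ε, q))
      (ContinuousLinearMap.inr ℝ ℝ E) q := fun ε q => hasFDerivAt_prodMk_right ε q
  have hparam : ∀ (q : E) (ε : ℝ), HasDerivAt (fun ε : ℝ => (ε, q)) ((1 : ℝ), (0 : E)) ε :=
    fun q ε => (hasDerivAt_id ε).prodMk (hasDerivAt_const ε q)
  have h1 : (fun ε => fderiv ℝ (fun q => Ψ (ε, q)) p u) = fun ε => fderiv ℝ Ψ (ε, p) (0, u) := by
    funext ε
    have := ((hd (ε, p)).comp p (hspace ε p)).fderiv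
    simp only [Function.comp_def] at this
    rw [this]
    simp
  have h2 : V = fun q => fderiv ℝ Ψ (0, q) (1, 0) := by
    funext q
    exact (hV q).unique ((hd (0, q)).comp_hasDerivAt 0 (hparam q 0))
  have h3 : V' u = fderiv ℝ (fderiv ℝ Ψ) (0, p) (1, 0) (0, u) := by
    have h4 := ((ContinuousLinearMap.apply ℝ G ((1 : ℝ), (0 : E))).hasFDerivAt).comp p
      (hdd.comp p (hspace 0 p))
    rw [h2] at hV'
    have hsymm : IsSymmSndFDerivAt ℝ Ψ (0, p) := hΨ.contDiffAt.isSymmSndFDerivAt (by simp)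
    rw [hsymm.eq, hV'.unique h4]
    rfl
  rw [h1, h3]
  exact ((ContinuousLinearMap.apply ℝ G ((0 : ℝ), u)).hasFDerivAt).comp_hasDerivAt 0
    (hdd.comp_hasDerivAt 0 (hparam p 0))

end FirstVariation

section Reeb

lemma contDiff_fderiv_apply {h : P3 → ℝ} (hh : ContDiff ℝ (⊤ : ℕ∞) h) (u : P3) :
    ContDiff ℝ (⊤ : ℕ∞) fun q => fderiv ℝ h q u :=
  (hh.fderiv_right (m := (⊤ : ℕ∞)) (by simp)).clm_apply contDiff_const

lemma D2_comm {h : P3 → ℝ} (hh : ContDiff ℝ (⊤ : ℕ∞) h) (p u w : P3) :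
    D2 h p u w = D2 h p w u := by
  have key : ∀ u w, D2 h p u w = fderiv ℝ (fderiv ℝ h) p w u := fun u w => by
    have hd : HasFDerivAt (fderiv ℝ h) (fderiv ℝ (fderiv ℝ h) p) p :=
      ((hh.fderiv_right (m := (⊤ : ℕ∞)) (by simp)).differentiable (by simp) p).hasFDerivAt
    have := (((ContinuousLinearMap.apply ℝ ℝ u).hasFDerivAt).comp p hd).fderiv
    exact congrArg (fun l : P3 →L[ℝ] ℝ => l w) this
  have hsymm : IsSymmSndFDerivAt ℝ h p :=
    (contDiff_infty.1 hh 2).contDiffAt.isSymmSndFDerivAt (by simp)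
  rw [key, key, hsymm.eq]

lemma reebField_smul {h : P3 → ℝ} (hh : Differentiable ℝ h) (ε : ℝ) (p : P3) :
    reebField (ε • h) p = Real.exp (-(ε * h p)) •
      ((ε * (fderiv ℝ h p (0, 1, 0) - p.1 * fderiv ℝ h p (0, 0, 1)),
        -(ε * fderiv ℝ h p (1, 0, 0)),
        1 + ε * (p.1 * fderiv ℝ h p (1, 0, 0))) : P3) := by
  simp only [reebField, fderiv_const_smul (hh p), smul_apply, smul_eq_mul,
    Pi.smul_apply]
  congr 3 <;> ring

lemma contDiff_reebField_smul {h : P3 → ℝ} (hh : ContDiff ℝ (⊤ : ℕ∞) h) :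
    ContDiff ℝ (⊤ : ℕ∞) fun a : ℝ × P3 => reebField (a.1 • h) a.2 := by
  simp only [reebField_smul (hh.differentiable (by simp))]
  have hd : ∀ u : P3, ContDiff ℝ (⊤ : ℕ∞) fun a : ℝ × P3 => fderiv ℝ h a.2 u :=
    fun u => (contDiff_fderiv_apply hh u).comp contDiff_snd
  have h0 : ContDiff ℝ (⊤ : ℕ∞) fun a : ℝ × P3 => h a.2 := hh.comp contDiff_snd
  have h1 : ContDiff ℝ (⊤ : ℕ∞) fun a : ℝ × P3 => a.1 := contDiff_fst
  have h2 : ContDiff ℝ (⊤ : ℕ∞) fun a : ℝ × P3 => a.2.1 := contDiff_fst.comp contDiff_snd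
  exact (h1.mul h0).neg.exp.smul
    ((h1.mul ((hd _).sub (h2.mul (hd _)))).prodMk
      ((h1.mul (hd _)).neg.prodMk (contDiff_const.add (h1.mul (h2.mul (hd _))))))

/-- The derivative at `ε = 0` of the Reeb vector field of `e^{εh} λ`. -/
noncomputable def reebVariation (h : P3 → ℝ) (q : P3) : P3 :=
  (fderiv ℝ h q (0, 1, 0) - q.1 * fderiv ℝ h q (0, 0, 1),
    -fderiv ℝ h q (1, 0, 0),
    -h q + q.1 * fderiv ℝ h q (1, 0, 0))

lemma contDiff_reebVariation {h : P3 → ℝ} (hh : ContDiff ℝ (⊤ : ℕ∞) h) :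
    ContDiff ℝ (⊤ : ℕ∞) (reebVariation h) := by
  have hd := contDiff_fderiv_apply hh
  exact ((hd _).sub (contDiff_fst.mul (hd _))).prodMk
    ((hd _).neg.prodMk (hh.neg.add (contDiff_fst.mul (hd _))))

lemma hasDerivAt_reebField_smul {h : P3 → ℝ} (hh : Differentiable ℝ h) (q : P3) :
    HasDerivAt (fun ε : ℝ => reebField (ε • h) q) (reebVariation h q) 0 := by
  rw [funext fun ε => reebField_smul hh ε q]
  have hlin : ∀ c : ℝ, HasDerivAt (fun ε : ℝ => ε * c) c 0 := fun c => by
    simpa using (hasDerivAt_id (0 : ℝ)).mul_const c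
  have := (hlin (h q)).neg.exp.smul
    ((hlin (fderiv ℝ h q (0, 1, 0) - q.1 * fderiv ℝ h q (0, 0, 1))).prodMk
      ((hlin (fderiv ℝ h q (1, 0, 0))).neg.prodMk
        ((hlin (q.1 * fderiv ℝ h q (1, 0, 0))).const_add 1)))
  refine this.congr_deriv ?_
  simp [reebVariation, add_comm]

lemma fderiv_reebVariation_axis {U : Set P3} {h : P3 → ℝ} (hh : Admissible U h) (t : ℝ) (u : P3) :
    (fderiv ℝ (reebVariation h) (0, 0, t) u).1 = D2 h (0, 0, t) (0, 1, 0) u ∧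
      (fderiv ℝ (reebVariation h) (0, 0, t) u).2.1 = -D2 h (0, 0, t) (1, 0, 0) u := by
  obtain ⟨hs, -, -, hz⟩ := hh
  have hd : ∀ v, HasFDerivAt (fun q => fderiv ℝ h q v)
      (fderiv ℝ (fun q => fderiv ℝ h q v) (0, 0, t)) (0, 0, t) :=
    fun v => ((contDiff_fderiv_apply hs v).differentiable (by simp) _).hasFDerivAt
  have hh' : HasFDerivAt h (fderiv ℝ h (0, 0, t)) (0, 0, t) :=
    (hs.differentiable (by simp) _).hasFDerivAt
  have hx : HasFDerivAt (fun q : P3 => q.1) (ContinuousLinearMap.fst ℝ ℝ (ℝ × ℝ)) (0, 0, t) :=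
    hasFDerivAt_fst
  have hW : HasFDerivAt (reebVariation h) _ (0, 0, t) :=
    ((hd (0, 1, 0)).sub (hx.mul (hd (0, 0, 1)))).prodMk
      ((hd (1, 0, 0)).neg.prodMk (hh'.neg.add (hx.mul (hd (1, 0, 0)))))
  rw [hW.fderiv]
  simp [D2, hz]

lemma hasDerivAt_linearized_flow {U : Set P3} {h : P3 → ℝ} (hh : Admissible U h)
    {Φ : ℝ → ℝ → P3 → P3} (hΦ0 : ∀ ε p, Φ ε 0 p = p)
    (hΦ : ∀ ε t p, HasDerivAt (fun s => Φ ε s p) (reebField (ε • h) (Φ ε t p)) t)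
    (hΦs : ContDiff ℝ (⊤ : ℕ∞) (fun q : ℝ × P3 => Φ q.1 2 q.2)) (u : P3) :
    HasDerivAt (fun ε => fderiv ℝ (Φ ε 2) (0, 0, -1) u)
      (∫ t in (-1 : ℝ)..1, fderiv ℝ (reebVariation h) (0, 0, t) u) 0 := by
  have hd : Differentiable ℝ h := hh.1.differentiable (by simp)
  have hF := contDiff_reebField_smul hh.1
  have hF2 : ContDiff ℝ 2 fun a : ℝ × P3 => reebField (a.1 • h) a.2 :=
    contDiff_infty.1 hF 2
  have hW : ContDiff ℝ 1 (reebVariation h) :=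
    contDiff_infty.1 (contDiff_reebVariation hh.1) 1
  have hvar : ∀ q : P3, fderiv ℝ (fun a : ℝ × P3 => reebField (a.1 • h) a.2) (0, q) (1, 0) =
      reebVariation h q := fun q => by
    have hchain := ((hF2.differentiable two_ne_zero) (0, q)).hasFDerivAt.comp_hasDerivAt (0 : ℝ)
      ((hasDerivAt_id (0 : ℝ)).prodMk (hasDerivAt_const (0 : ℝ) q))
    exact hchain.unique (hasDerivAt_reebField_smul hd q)
  have hV : ∀ q : P3, HasDerivAt (fun ε => Φ ε 2 q)
      (∫ s in (0 : ℝ)..2, reebVariation h (q + s • ((0, 0, 1) : P3))) 0 := fun q => by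
    have := hasDerivAt_flow_of_const hF2 (e := (0, 0, 1))
      (fun q => (reebField_smul hd 0 q).trans (by simp)) zero_le_two q (γ := fun ε t => Φ ε t q)
      (fun ε => hΦ0 ε q) (fun ε t => hΦ ε t q)
    simpa only [hvar] using this
  have key := hasDerivAt_fderiv_apply_of_contDiff (contDiff_infty.1 hΦs 2) hV
    (hasFDerivAt_integral_along_line hW (0, 0, 1) (0, 0, -1) 2) u
  have hcont : Continuous fun s : ℝ =>
      fderiv ℝ (reebVariation h) ((0, 0, -1) + s • ((0, 0, 1) : P3)) :=
    (hW.continuous_fderiv one_ne_zero).comp (by fun_prop)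
  rw [ContinuousLinearMap.intervalIntegral_apply (hcont.intervalIntegrable _ _)] at key
  have hshift := intervalIntegral.integral_comp_add_left (a := 0) (b := 2)
    (fun t => fderiv ℝ (reebVariation h) (0, 0, t) u) (-1)
  norm_num at hshift
  rw [← hshift]
  simpa using key

lemma hasDerivAt_linearized_flow_components {U : Set P3} {h : P3 → ℝ} (hh : Admissible U h)
    {Φ : ℝ → ℝ → P3 → P3} (hΦ0 : ∀ ε p, Φ ε 0 p = p)
    (hΦ : ∀ ε t p, HasDerivAt (fun s => Φ ε s p) (reebField (ε • h) (Φ ε t p)) t)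
    (hΦs : ContDiff ℝ (⊤ : ℕ∞) (fun q : ℝ × P3 => Φ q.1 2 q.2)) (u : P3) :
    HasDerivAt (fun ε => (fderiv ℝ (Φ ε 2) (0, 0, -1) u).1)
        (∫ t in (-1 : ℝ)..1, D2 h (0, 0, t) (0, 1, 0) u) 0 ∧
      HasDerivAt (fun ε => (fderiv ℝ (Φ ε 2) (0, 0, -1) u).2.1)
        (∫ t in (-1 : ℝ)..1, -D2 h (0, 0, t) (1, 0, 0) u) 0 := by
  have key := hasDerivAt_linearized_flow hh hΦ0 hΦ hΦs u
  have hcont : Continuous fun t : ℝ => fderiv ℝ (reebVariation h) (0, 0, t) u :=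
    (((contDiff_reebVariation hh.1).continuous_fderiv (by simp)).comp
      (by fun_prop)).clm_apply continuous_const
  have happly : ∀ l : P3 →L[ℝ] ℝ, HasDerivAt (fun ε => l (fderiv ℝ (Φ ε 2) (0, 0, -1) u))
      (∫ t in (-1 : ℝ)..1, l (fderiv ℝ (reebVariation h) (0, 0, t) u)) 0 := fun l => by
    rw [l.intervalIntegral_comp_comm (hcont.intervalIntegrable _ _)]
    exact l.hasFDerivAt.comp_hasDerivAt 0 key
  have h1 := happly (.fst ℝ ℝ (ℝ × ℝ))
  have h2 := happly ((ContinuousLinearMap.fst ℝ ℝ ℝ).comp (.snd ℝ ℝ (ℝ × ℝ)))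
  simp only [ContinuousLinearMap.comp_apply, ContinuousLinearMap.coe_fst',
    ContinuousLinearMap.coe_snd', (fderiv_reebVariation_axis hh _ u).1,
    (fderiv_reebVariation_axis hh _ u).2] at h1 h2
  exact ⟨h1, h2⟩

end Reeb

section Submersion

open Metric

/-- The product of a function `b` with the quadratic form `α x² / 2 + β x y + γ y² / 2`. -/
noncomputable def mulQuadratic (b : P3 → ℝ) (α β γ : ℝ) (q : P3) : ℝ :=
  b q * (α / 2 * q.1 ^ 2 + β * (q.1 * q.2.1) + γ / 2 * q.2.1 ^ 2)

lemma fderiv_mulQuadratic {b : P3 → ℝ} (hb : Differentiable ℝ b) (α β γ : ℝ) (q u : P3) :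
    fderiv ℝ (mulQuadratic b α β γ) q u =
      b q * (q.1 * (α * u.1 + β * u.2.1) + q.2.1 * (β * u.1 + γ * u.2.1)) +
        (α / 2 * q.1 ^ 2 + β * (q.1 * q.2.1) + γ / 2 * q.2.1 ^ 2) * fderiv ℝ b q u := by
  have hx : HasFDerivAt (fun q : P3 => q.1) (ContinuousLinearMap.fst ℝ ℝ (ℝ × ℝ)) q :=
    hasFDerivAt_fst
  have hy : HasFDerivAt (fun q : P3 => q.2.1)
      ((ContinuousLinearMap.fst ℝ ℝ ℝ).comp (.snd ℝ ℝ (ℝ × ℝ))) q :=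
    hasFDerivAt_fst.comp q hasFDerivAt_snd
  have : HasFDerivAt (mulQuadratic b α β γ) _ q :=
    (hb q).hasFDerivAt.mul ((((hx.pow 2).const_mul (α / 2)).add ((hx.mul hy).const_mul β)).add
      ((hy.pow 2).const_mul (γ / 2)))
  rw [this.fderiv]
  simp
  ring

lemma D2_mulQuadratic_axis {b : P3 → ℝ} (hb : ContDiff ℝ (⊤ : ℕ∞) b) (α β γ t : ℝ) (u w : P3) :
    D2 (mulQuadratic b α β γ) (0, 0, t) u w =
      b (0, 0, t) * (w.1 * (α * u.1 + β * u.2.1) + w.2.1 * (β * u.1 + γ * u.2.1)) := by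
  have hbd : Differentiable ℝ b := hb.differentiable (by simp)
  simp only [D2, fderiv_mulQuadratic hbd]
  have hx : HasFDerivAt (fun q : P3 => q.1) (ContinuousLinearMap.fst ℝ ℝ (ℝ × ℝ)) (0, 0, t) :=
    hasFDerivAt_fst
  have hy : HasFDerivAt (fun q : P3 => q.2.1)
      ((ContinuousLinearMap.fst ℝ ℝ ℝ).comp (.snd ℝ ℝ (ℝ × ℝ))) (0, 0, t) :=
    hasFDerivAt_fst.comp _ hasFDerivAt_snd
  have hb' := ((contDiff_fderiv_apply hb u).differentiable (by simp) (0, 0, t)).hasFDerivAt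
  have := ((hbd (0, 0, t)).hasFDerivAt.mul ((hx.mul_const (α * u.1 + β * u.2.1)).add
      (hy.mul_const (β * u.1 + γ * u.2.1)))).add
    (((((hx.pow 2).const_mul (α / 2)).add ((hx.mul hy).const_mul β)).add
      ((hy.pow 2).const_mul (γ / 2))).mul hb')
  refine (congrArg (fun l : P3 →L[ℝ] ℝ => l w) this.fderiv).trans ?_
  simp
  ring

lemma admissible_mulQuadratic {U : Set P3} {b : P3 → ℝ} (hb : ContDiff ℝ (⊤ : ℕ∞) b)
    (hbU : tsupport b ⊆ U) (α β γ : ℝ) : Admissible U (mulQuadratic b α β γ) := by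
  refine ⟨?_, (tsupport_mul_subset_left).trans hbU, fun z => by simp [mulQuadratic], fun z => ?_⟩
  · have hx : ContDiff ℝ (⊤ : ℕ∞) fun q : P3 => q.1 := contDiff_fst
    have hy : ContDiff ℝ (⊤ : ℕ∞) fun q : P3 => q.2.1 := contDiff_fst.comp contDiff_snd
    exact hb.mul (((contDiff_const.mul (hx.pow 2)).add (contDiff_const.mul (hx.mul hy))).add
      (contDiff_const.mul (hy.pow 2)))
  · ext <;> simp [fderiv_mulQuadratic (hb.differentiable (by simp))]

lemma exists_bump_integral_axis_pos {U : Set P3} (hU : IsOpen U)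
    (hU0 : ((0 : ℝ), (0 : ℝ), (0 : ℝ)) ∈ U) :
    ∃ b : P3 → ℝ, ContDiff ℝ (⊤ : ℕ∞) b ∧ tsupport b ⊆ U ∧
      0 < ∫ t in (-1 : ℝ)..1, b (0, 0, t) := by
  obtain ⟨r, hr, hrU⟩ := Metric.isOpen_iff.1 hU _ hU0
  let b : ContDiffBump ((0, 0, 0) : P3) := ⟨r / 4, r / 2, by positivity, by linarith⟩
  refine ⟨b, b.contDiff, ?_, ?_⟩
  · rw [b.tsupport_eq]
    exact (closedBall_subset_ball (by change r / 2 < r; linarith)).trans hrU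
  · have hcont : Continuous fun t : ℝ => b (0, 0, t) := b.continuous.comp (by fun_prop)
    refine intervalIntegral.integral_pos (by norm_num) hcont.continuousOn
      (fun t _ => b.nonneg) ⟨0, by norm_num, ?_⟩
    rw [b.one_of_mem_closedBall (mem_closedBall_self b.rIn_pos.le)]
    exact one_pos

end Submersion

/-- Lemma 4.7: for the standard contact form `λ = x dy + dz` on `ℝ³` and admissible
perturbations `f = ε h` supported in `U` (a neighborhood of `0` avoiding `(0,0,±1)`),
the derivative at `ε = 0` of the linearized time-2 Reeb flow `A(εh)` of `e^{εh}λ`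
from `ξ_{(0,0,-1)}` to `ξ_{(0,0,1)}` (in the frame `(∂_x, ∂_y)`) is
`(dA)₀(h) = ∫_{-1}^{1} [[h_{xy}, h_{yy}], [-h_{xx}, -h_{xy}]](0,0,t) dt`;
consequently `A` is submersive at `0` onto the symplectic maps (whose tangent space
at the identity consists of trace-zero matrices). -/
theorem stmt_8 (U : Set P3) (hUopen : IsOpen U) (hU0 : ((0:ℝ), (0:ℝ), (0:ℝ)) ∈ U)
    (hU1 : ((0:ℝ), (0:ℝ), (1:ℝ)) ∉ U) (hU2 : ((0:ℝ), (0:ℝ), (-1:ℝ)) ∉ U) :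
    (∀ h : P3 → ℝ, Admissible U h →
      ∀ Φ : ℝ → ℝ → P3 → P3,
        (∀ ε p, Φ ε 0 p = p) →
        (∀ ε t p, HasDerivAt (fun s => Φ ε s p) (reebField (ε • h) (Φ ε t p)) t) →
        ContDiff ℝ (⊤ : ℕ∞) (fun q : ℝ × P3 => Φ q.1 2 q.2) →
        (HasDerivAt (fun ε => (fderiv ℝ (Φ ε 2) (0, 0, -1) (1, 0, 0)).1)
            (∫ t in (-1:ℝ)..1, D2 h (0, 0, t) (1, 0, 0) (0, 1, 0)) 0 ∧
         HasDerivAt (fun ε => (fderiv ℝ (Φ ε 2) (0, 0, -1) (0, 1, 0)).1)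
            (∫ t in (-1:ℝ)..1, D2 h (0, 0, t) (0, 1, 0) (0, 1, 0)) 0 ∧
         HasDerivAt (fun ε => (fderiv ℝ (Φ ε 2) (0, 0, -1) (1, 0, 0)).2.1)
            (∫ t in (-1:ℝ)..1, -D2 h (0, 0, t) (1, 0, 0) (1, 0, 0)) 0 ∧
         HasDerivAt (fun ε => (fderiv ℝ (Φ ε 2) (0, 0, -1) (0, 1, 0)).2.1)
            (∫ t in (-1:ℝ)..1, -D2 h (0, 0, t) (1, 0, 0) (0, 1, 0)) 0)) ∧
    (∀ W : Matrix (Fin 2) (Fin 2) ℝ, Matrix.trace W = 0 →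
      ∃ h : P3 → ℝ, Admissible U h ∧
        (∫ t in (-1:ℝ)..1, D2 h (0, 0, t) (1, 0, 0) (0, 1, 0)) = W 0 0 ∧
        (∫ t in (-1:ℝ)..1, D2 h (0, 0, t) (0, 1, 0) (0, 1, 0)) = W 0 1 ∧
        (∫ t in (-1:ℝ)..1, -D2 h (0, 0, t) (1, 0, 0) (1, 0, 0)) = W 1 0 ∧
        (∫ t in (-1:ℝ)..1, -D2 h (0, 0, t) (1, 0, 0) (0, 1, 0)) = W 1 1) := by
  refine ⟨fun h hh Φ hΦ0 hΦ hΦs => ?_, fun W hW => ?_⟩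
  · have hcomp := hasDerivAt_linearized_flow_components hh hΦ0 hΦ hΦs
    have hx := hcomp (1, 0, 0)
    have hy := hcomp (0, 1, 0)
    simp only [D2_comm hh.1 _ (0, 1, 0) (1, 0, 0)] at hx
    exact ⟨hx.1, hy.1, hx.2, hy.2⟩
  · obtain ⟨b, hb, hbU, hc⟩ := exists_bump_integral_axis_pos hUopen hU0
    set c := ∫ t in (-1 : ℝ)..1, b (0, 0, t) with hcdef
    have hc0 : c ≠ 0 := hc.ne'
    rw [Matrix.trace_fin_two] at hW
    refine ⟨mulQuadratic b (-W 1 0 / c) (W 0 0 / c) (W 0 1 / c),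
      admissible_mulQuadratic hb hbU _ _ _, ?_⟩
    simp only [D2_mulQuadratic_axis hb, intervalIntegral.integral_neg,
      intervalIntegral.integral_mul_const, ← hcdef]
    refine ⟨?_, ?_, ?_, ?_⟩ <;> field_simp <;> linarith
end
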